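/- arXiv:2507.09939 — 15 statements merged into one kernel-verified Lean document; each statement's English description precedes it below -/
import Mathlib

section
/- Let a, w ∈ 𝒜. The following are equivalent: (1) a is w-EP; (2) there exists x ∈ 𝒜 such that a(wx)² = x, x(wa)² = a, and (xwaw)* = xwaw; (3) a is w-group invertible with w-group inverse x satisfying (awxw)* = awxw. -/
variable {A : Type*} [NormedRing A] [StarRing A] [NormedAlgebra ℂ A] [CompleteSpace A]

/-- `q` is quasinilpotent: `‖q^n‖^(1/n) → 0`. -/
def IsQuasinilpotent (q : A) : Prop :=
  Filter.Tendsto (fun n : ℕ => ‖q ^ n‖ ^ (1 / (n : ℝ))) Filter.atTop (nhds 0)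

/-- `a` is `w`-EP. -/
def IsWEP (w a : A) : Prop :=
  ∃ x : A, a * (w * x) ^ 2 = x ∧ x * (w * a) ^ 2 = a ∧
    star (a * w * x * w) = a * w * x * w ∧ star (x * w * a * w) = x * w * a * w

/-- `x` is a `w`-group inverse of `a`. -/
def IsWGroupInv (w a x : A) : Prop :=
  a * w * x * w * a = a ∧ x * w * a * w * x = x ∧ a * w * x = x * w * a

/-- `a` is generalized `w`-EP. -/
def IsGenWEP (w a : A) : Prop :=
  ∃ x : A, a * (w * x) ^ 2 = x ∧ star (a * w * x * w) = a * w * x * w ∧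
    star (x * w * a * w) = x * w * a * w ∧
    Filter.Tendsto
      (fun n : ℕ => ‖(a * w) ^ n - x * w * (a * w) ^ (n + 1)‖ ^ (1 / (n : ℝ)))
      Filter.atTop (nhds 0)

/-- `a` is `w`-*-DMP. -/
def IsWStarDMP (w a : A) : Prop :=
  ∃ x : A, ∃ n : ℕ, 1 ≤ n ∧ a * (w * x) ^ 2 = x ∧
    star (a * w * x * w) = a * w * x * w ∧ star (x * w * a * w) = x * w * a * w ∧
    (a * w) ^ n = x * w * (a * w) ^ (n + 1)

/-- The explicit `w`-group inverse `(xw)² a` of an element `a` with `a (w x)² = x` and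
`x (w a)² = a`. -/
theorem isWGroupInv_of_mul_sq {R : Type*} [NormedRing R] {a w x : R}
    (hx : a * (w * x) ^ 2 = x) (ha : x * (w * a) ^ 2 = a) :
    IsWGroupInv w a (x * w * (x * w) * a) ∧
      a * w * (x * w * (x * w) * a) * w = x * w * a * w := by
  have ha' : x * w * (a * w * a) = a := by simpa only [sq, mul_assoc] using ha
  have hx' : a * w * (x * w * x) = x := by simpa only [sq, mul_assoc] using hx
  have left_mul : a * w * (x * w * (x * w) * a) = x * w * a := by
    calc _ = a * w * (x * w * x) * w * a := by noncomm_ring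
      _ = _ := by rw [hx']
  have right_mul : x * w * (x * w) * a * w * a = x * w * a := by
    calc _ = x * w * (x * w * (a * w * a)) := by noncomm_ring
      _ = _ := by rw [ha']
  have inner_mul : x * w * a * w * x = x := by
    calc _ = x * w * a * w * (a * w * (x * w * x)) := by rw [hx']
      _ = x * w * (a * w * a) * w * (x * w * x) := by noncomm_ring
      _ = x := by rw [ha', hx']
  refine ⟨⟨?_, ?_, ?_⟩, by rw [left_mul]⟩
  · rw [left_mul]
    simpa only [mul_assoc] using ha'
  · rw [right_mul]
    calc _ = x * w * a * w * x * w * (x * w) * a := by noncomm_ring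
      _ = _ := by rw [inner_mul]
  · rw [left_mul, right_mul]

theorem stmt_0 (a w : A) :
    [ IsWEP w a,
      (∃ x : A, a * (w * x) ^ 2 = x ∧ x * (w * a) ^ 2 = a ∧
        star (x * w * a * w) = x * w * a * w),
      (∃ x : A, IsWGroupInv w a x ∧ star (a * w * x * w) = a * w * x * w) ].TFAE := by
  tfae_have 1 → 2 := fun ⟨x, hx, ha, _, hs⟩ => ⟨x, hx, ha, hs⟩
  tfae_have 2 → 3 := by
    rintro ⟨x, hx, ha, hs⟩
    obtain ⟨hinv, heq⟩ := isWGroupInv_of_mul_sq hx ha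
    exact ⟨_, hinv, by rw [heq, hs]⟩
  tfae_have 3 → 1 := by
    rintro ⟨x, ⟨ha, hx, hcomm⟩, hs⟩
    refine ⟨x, ?_, ?_, hs, by rw [← hcomm, hs]⟩
    · calc _ = a * w * x * w * x := by noncomm_ring
        _ = x := by rw [hcomm, hx]
    · calc _ = x * w * a * w * a := by noncomm_ring
        _ = a := by rw [← hcomm, ha]
  tfae_finish
end

section
/- Let a, w ∈ 𝒜. The following are equivalent: (1) a is w-EP; (2) there exists x ∈ 𝒜 such that (aw)²x = a, awx = xwa, and (awxw)* = awxw; (3) there exists x ∈ 𝒜 such that (aw)²x = a, (xw)²a = x, and (awxw)* = awxw. -/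
variable {A : Type*} [NormedRing A] [StarRing A] [NormedAlgebra ℂ A] [CompleteSpace A]

/-- If `y * b ^ 2 = b` and `b * y ^ 2 = y` with both `b * y` and `y * b` self-adjoint, then `b` and
`y` commute. -/
theorem commute_of_isSelfAdjoint_mul {R : Type*} [Semigroup R] [StarMul R] {b y : R}
    (hb : y * b * b = b) (hy : b * y * y = y) (h : star (b * y) = b * y)
    (h' : star (y * b) = y * b) : b * y = y * b := by
  have e : (y * b) * (b * y) = b * y := by rw [← mul_assoc, hb]
  have e' : (b * y) * (y * b) = y * b := by rw [← mul_assoc, hy]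
  have e'' := congrArg star e'
  rw [star_mul, h, h', e] at e''
  exact e''

/-- If `b ^ 2 * y = b` and `y ^ 2 * b = y`, then `y` is an inner inverse of `b`. -/
theorem mul_mul_eq_of_sq_mul_eq {R : Type*} [Semigroup R] {b y : R}
    (hb : b * b * y = b) (hy : y * y * b = y) : b * y * b = b := by
  calc b * y * b = b * b * y * y * b := by rw [hb]
    _ = b * b * (y * y * b) := by simp only [mul_assoc]
    _ = b := by rw [hy, hb]

theorem stmt_1 (a w : A) :
    [ IsWEP w a,
      (∃ x : A, (a * w) ^ 2 * x = a ∧ a * w * x = x * w * a ∧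
        star (a * w * x * w) = a * w * x * w),
      (∃ x : A, (a * w) ^ 2 * x = a ∧ (x * w) ^ 2 * a = x ∧
        star (a * w * x * w) = a * w * x * w) ].TFAE := by
  tfae_have 1 → 2 := by
    rintro ⟨x, hx, ha, h, h'⟩
    obtain ⟨b, hb⟩ : ∃ b, b = a * w := ⟨_, rfl⟩
    obtain ⟨y, hy⟩ : ∃ y, y = x * w := ⟨_, rfl⟩
    have ha : y * b * a = a := by simpa only [hb, hy, pow_two, mul_assoc] using ha
    have hx : b * y * x = x := by simpa only [hb, hy, pow_two, mul_assoc] using hx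
    have h : star (b * y) = b * y := by simpa only [hb, hy, mul_assoc] using h
    have h' : star (y * b) = y * b := by simpa only [hb, hy, mul_assoc] using h'
    have hbb : y * b * b = b := by rw [hb, ← mul_assoc, ← hb, ha, ← hb]
    have hyy : b * y * y = y := by rw [hy, ← mul_assoc, ← hy, hx, ← hy]
    have hc : b * y = y * b := commute_of_isSelfAdjoint_mul hbb hyy h h'
    have hzw : y * y * a * w = y := by
      rw [mul_assoc _ a w, ← hb, mul_assoc, ← hc, ← mul_assoc, ← hc, hyy]
    have hbz : b * (y * y * a) = y * a := by rw [← mul_assoc, ← mul_assoc, hyy]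
    refine ⟨y * y * a, ?_, ?_, ?_⟩
    · rw [← hb, pow_two, mul_assoc, hbz, ← mul_assoc, hc, ha]
    · rw [hzw, ← hb, hbz]
    · rw [mul_assoc (a * w), hzw, ← hb, h]
  tfae_have 2 → 3 := by
    rintro ⟨x, ha, hc, h⟩
    obtain ⟨b, hb⟩ : ∃ b, b = a * w := ⟨_, rfl⟩
    obtain ⟨y, hy⟩ : ∃ y, y = x * w := ⟨_, rfl⟩
    have ha : b * b * x = a := by rw [← ha, pow_two, hb]
    have hbb : b * b * y = b := by rw [hy, ← mul_assoc, ha, hb]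
    have hc : b * y = y * b := by
      simpa only [hb, hy, mul_assoc] using congrArg (· * w) hc
    have h : star (b * y) = b * y := by simpa only [hb, hy, mul_assoc] using h
    have hbyb : b * y * b = b := by rw [mul_assoc, ← hc, ← mul_assoc, hbb]
    have hya : b * y * a = a := by
      rw [← ha, ← mul_assoc, ← mul_assoc, hbyb]
    have hzw : y * y * a * w = y * (b * y) := by
      rw [mul_assoc _ a w, ← hb, mul_assoc, ← hc]
    have hbz : b * (y * y * a) = y * a := by
      rw [← mul_assoc, ← mul_assoc, hc, mul_assoc y, mul_assoc y, hya]
    have hidem : b * (y * (b * y)) = b * y := by rw [← mul_assoc, ← mul_assoc, hbyb]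
    refine ⟨y * y * a, ?_, ?_, ?_⟩
    · rw [← hb, pow_two, mul_assoc, hbz, ← mul_assoc, hya]
    · rw [hzw, pow_two]
      calc y * (b * y) * (y * (b * y)) * a = y * (b * (y * y * (b * y * a))) := by
            simp only [mul_assoc]
        _ = y * y * a := by rw [hya, hbz, ← mul_assoc]
    · rw [mul_assoc (a * w), hzw, ← hb, hidem, h]
  tfae_have 3 → 1 := by
    rintro ⟨x, ha, hx, h⟩
    obtain ⟨b, hb⟩ : ∃ b, b = a * w := ⟨_, rfl⟩
    obtain ⟨y, hy⟩ : ∃ y, y = x * w := ⟨_, rfl⟩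
    have ha : b * b * x = a := by rw [← ha, pow_two, hb]
    have hx : y * y * a = x := by rw [← hx, pow_two, hy]
    have hbb : b * b * y = b := by rw [hy, ← mul_assoc, ha, hb]
    have hyy : y * y * b = y := by rw [hb, ← mul_assoc, hx, hy]
    have h : star (b * y) = b * y := by simpa only [hb, hy, mul_assoc] using h
    have hbyb : b * y * b = b := mul_mul_eq_of_sq_mul_eq hbb hyy
    have hya : b * y * a = a := by
      rw [← ha, ← mul_assoc, ← mul_assoc, hbyb]
    have hzw : b * y * x * w = b * y * y := by rw [mul_assoc _ x w, ← hy]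
    have hbg : b * (b * y * y) = b * y := by rw [← mul_assoc, ← mul_assoc, hbb]
    have hgb : b * y * y * b = b * y := by rw [mul_assoc b, mul_assoc, hyy]
    refine ⟨b * y * x, ?_, ?_, ?_, ?_⟩
    · calc a * (w * (b * y * x)) ^ 2 = a * w * (b * y * x * w) * (b * y * x) := by
            simp only [pow_two, mul_assoc]
        _ = b * y * b * y * x := by rw [hzw, ← hb, hbg]; simp only [mul_assoc]
        _ = b * y * x := by rw [hbyb]
    · calc b * y * x * (w * a) ^ 2 = b * y * x * w * (a * w) * a := by
            simp only [pow_two, mul_assoc]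
        _ = a := by rw [hzw, ← hb, hgb, hya]
    · rw [mul_assoc (a * w), hzw, ← hb, hbg, h]
    · rw [hzw, mul_assoc _ a w, ← hb, hgb, h]
  tfae_finish
end

section
/- Let a, w ∈ 𝒜. Then a is w-EP if and only if a is w-group invertible and a𝒜 = (aw)*𝒜 (that is, the sets {a·r : r ∈ 𝒜} and {(aw)*·r : r ∈ 𝒜} coincide). -/
variable {A : Type*} [NormedRing A] [StarRing A] [NormedAlgebra ℂ A] [CompleteSpace A]

theorem mul_comm_of_isSelfAdjoint_mul {R : Type*} [Semigroup R] [StarMul R] {b y : R}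
    (hy : b * y * y = y) (hb : y * b * b = b) (hby : IsSelfAdjoint (b * y))
    (hyb : IsSelfAdjoint (y * b)) : b * y = y * b := by
  have h₁ : y * b * (b * y) = b * y := by rw [← mul_assoc, hb]
  have h₂ : b * y * (y * b) = y * b := by rw [← mul_assoc, hy]
  calc b * y = star (y * b * (b * y)) := by rw [h₁, hby.star_eq]
    _ = b * y * (y * b) := by rw [star_mul, hby.star_eq, hyb.star_eq]
    _ = y * b := h₂

theorem range_mul_left_eq_of_eq_mul {R : Type*} [Semigroup R] {a b s t : R}
    (ha : b * s = a) (hb : a * t = b) :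
    (Set.range fun r : R => a * r) = Set.range fun r : R => b * r := by
  ext z
  constructor
  · rintro ⟨r, rfl⟩
    exact ⟨s * r, by simp only [← mul_assoc, ha]⟩
  · rintro ⟨r, rfl⟩
    exact ⟨t * r, by simp only [← mul_assoc, hb]⟩

theorem stmt_2 (a w : A) :
    IsWEP w a ↔
      ((∃ x : A, IsWGroupInv w a x) ∧
        (Set.range fun r : A => a * r) = Set.range fun r : A => star (a * w) * r) := by
  constructor
  · rintro ⟨x, h1, h2, h3, h4⟩
    have hb : x * w * (a * w) * (a * w) = a * w := by
      conv_rhs => rw [← h2]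
      noncomm_ring
    have hy : a * w * (x * w) * (x * w) = x * w := by
      conv_rhs => rw [← h1]
      noncomm_ring
    have hya : x * w * (a * w) * a = a := by
      conv_rhs => rw [← h2]
      noncomm_ring
    have haw : star (a * w * (x * w)) = a * w * (x * w) := by simpa only [mul_assoc] using h3
    have hxw : star (x * w * (a * w)) = x * w * (a * w) := by simpa only [mul_assoc] using h4
    have hcomm := mul_comm_of_isSelfAdjoint_mul hy hb haw hxw
    have haa : a * w * (x * w) * a = a := by rw [hcomm, hya]
    have hbb : a * w * (x * w * (a * w)) = a * w := by rw [← mul_assoc, hcomm, hb]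
    have hl : a * w * (x * w * (x * w) * a) = x * w * a := by
      rw [← mul_assoc, ← mul_assoc, hy]
    have hr : x * w * (x * w) * a * w * a = x * w * a := by
      calc _ = x * w * (x * w * (a * w) * a) := by noncomm_ring
        _ = _ := by rw [hya]
    refine ⟨⟨x * w * (x * w) * a, ?_, ?_, hl.trans hr.symm⟩, ?_⟩
    · rw [hl]
      calc _ = x * w * (a * w) * a := by noncomm_ring
        _ = a := hya
    · rw [hr]
      calc _ = x * w * (a * w * (x * w) * (x * w)) * a := by noncomm_ring
        _ = _ := by rw [hy]
    · refine range_mul_left_eq_of_eq_mul (s := star (x * w) * a) (t := w * (x * w) * star (a * w))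
        ?_ ?_
      · rw [← mul_assoc, ← star_mul, hxw, hya]
      · have h := congrArg star hbb
        rw [star_mul, hxw, ← hcomm] at h
        simpa only [mul_assoc] using h
  · rintro ⟨⟨x, h1, h2, h3⟩, hrange⟩
    obtain ⟨s, hs⟩ : star (a * w) ∈ Set.range fun r : A => a * r :=
      hrange ▸ ⟨1, mul_one _⟩
    have hp : a * w * x * w * star (a * w) = star (a * w) := by
      rw [← hs]
      simp only [← mul_assoc]
      rw [h1]
    have hp' : a * w * star (a * w * x * w) = a * w := by
      simpa only [star_mul, star_star, mul_assoc] using congrArg star hp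
    have hsa : IsSelfAdjoint (a * w * x * w) := by
      have h : a * w * x * w * star (a * w * x * w) = a * w * x * w := by
        calc _ = x * w * (a * w * star (a * w * x * w)) := by
              rw [h3]; simp only [mul_assoc]
          _ = _ := by rw [hp', h3]; simp only [mul_assoc]
      rw [← h]
      exact IsSelfAdjoint.mul_star_self _
    refine ⟨x, ?_, ?_, hsa, ?_⟩
    · calc _ = a * w * x * w * x := by noncomm_ring
        _ = x := by rw [h3, h2]
    · calc _ = x * w * a * w * a := by noncomm_ring
        _ = a := by rw [← h3, h1]
    · rw [← h3]
      exact hsa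
end

section
/- Let a, w ∈ 𝒜. The following are equivalent: (1) a is w-EP; (2) there exists x ∈ 𝒜 such that x(wa)² = a and (awxw)* = xwaw; (3) there exists x ∈ 𝒜 such that (aw)²x = a and (awxw)* = xwaw. -/
variable {A : Type*} [NormedRing A] [StarRing A] [NormedAlgebra ℂ A] [CompleteSpace A]

/-- If `b = y * b ^ 2`, `y = b * y ^ 2` and both products are self-adjoint, then `b` and `y`
commute. -/
theorem commute_of_mul_sq_eq {M : Type*} [Monoid M] [StarMul M] {b y : M}
    (hb : y * b * b = b) (hy : b * y * y = y)
    (h₁ : star (b * y) = b * y) (h₂ : star (y * b) = y * b) : b * y = y * b := by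
  have h : y * b * (b * y) = b * y := by rw [← mul_assoc, hb]
  have h' : b * y * (y * b) = y * b := by rw [← mul_assoc, hy]
  have hs := congrArg star h
  rw [star_mul, h₁, h₂, h'] at hs
  exact hs.symm

theorem commute_of_star_mul_eq_of_left {M : Type*} [Monoid M] [StarMul M] {b y : M}
    (hb : y * b * b = b) (h : star (b * y) = y * b) : b * y = y * b := by
  have h' : y * b * (b * y) = b * y := by rw [← mul_assoc, hb]
  have hs := congrArg star h'
  rw [star_mul, h, ← h, star_star, h, h'] at hs
  exact hs

theorem commute_of_star_mul_eq_of_right {M : Type*} [Monoid M] [StarMul M] {b y : M}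
    (hb : b * (b * y) = b) (h : star (b * y) = y * b) : b * y = y * b := by
  have h' : y * b * (b * y) = y * b := by rw [mul_assoc, hb]
  have hs := congrArg star h'
  rw [star_mul, h, ← h, star_star, h, h'] at hs
  exact hs.symm

theorem mul_sq_mul_mul_eq {M : Type*} [Monoid M] {a w y : M}
    (ha : y * (a * w) * a = a) (hc : a * w * y = y * (a * w)) :
    a * w * (y * y * a) * w = a * w * y := by
  calc _ = a * w * y * (y * (a * w)) := by simp only [mul_assoc]
    _ = y * (a * w) * (a * w * y) := by rw [hc]
    _ = y * (a * w) * a * w * y := by simp only [mul_assoc]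
    _ = _ := by rw [ha]

theorem sq_mul_mul_mul_eq {M : Type*} [Monoid M] {a w y : M}
    (ha : y * (a * w) * a = a) :
    y * y * a * w * a * w = y * (a * w) := by
  calc _ = y * (y * (a * w) * a) * w := by simp only [mul_assoc]
    _ = _ := by rw [ha, mul_assoc]

theorem stmt_3 (a w : A) :
    [ IsWEP w a,
      (∃ x : A, x * (w * a) ^ 2 = a ∧ star (a * w * x * w) = x * w * a * w),
      (∃ x : A, (a * w) ^ 2 * x = a ∧ star (a * w * x * w) = x * w * a * w) ].TFAE := by
  tfae_have 1 → 2 := by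
    rintro ⟨x, hx, ha, h₁, h₂⟩
    refine ⟨x, ha, ?_⟩
    have hb : x * w * (a * w) * (a * w) = a * w := by
      calc _ = x * (w * a) ^ 2 * w := by noncomm_ring
        _ = _ := by rw [ha]
    have hy : a * w * (x * w) * (x * w) = x * w := by
      calc _ = a * (w * x) ^ 2 * w := by noncomm_ring
        _ = _ := by rw [hx]
    have hc := commute_of_mul_sq_eq hb hy (by simpa only [mul_assoc] using h₁)
      (by simpa only [mul_assoc] using h₂)
    rw [h₁]
    simpa only [mul_assoc] using hc
  tfae_have 2 → 1 := by
    rintro ⟨x, ha, h⟩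
    have hpa : x * w * (a * w) * a = a := by
      calc _ = x * (w * a) ^ 2 := by noncomm_ring
        _ = _ := ha
    have hs : star (a * w * (x * w)) = x * w * (a * w) := by
      simpa only [mul_assoc] using h
    have hc := commute_of_star_mul_eq_of_left (by rw [← mul_assoc, hpa]) hs
    have hq : a * w * (x * w) * a = a := by rw [hc, hpa]
    have hw₁ := mul_sq_mul_mul_eq hpa hc
    have hw₂ := (sq_mul_mul_mul_eq hpa).trans hc.symm
    have hsa : star (a * w * (x * w)) = a * w * (x * w) := by rw [hs, hc]
    refine ⟨x * w * (x * w) * a, ?_, ?_, by rw [hw₁, hsa], by rw [hw₂, hsa]⟩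
    · calc _ = a * w * (x * w * (x * w) * a) * w * (x * w * (x * w) * a) := by noncomm_ring
        _ = a * w * (x * w * (x * w)) * (x * w * a) := by rw [hw₁]; noncomm_ring
        _ = x * w * (x * w) * (a * w) * (x * w * a) := by rw [Commute.mul_right hc hc]
        _ = x * w * (x * w) * (a * w * (x * w) * a) := by noncomm_ring
        _ = _ := by rw [hq]
    · calc _ = x * w * (x * w) * a * w * a * w * a := by noncomm_ring
        _ = _ := by rw [hw₂, hq]
  tfae_have 2 → 3 := by
    rintro ⟨x, ha, h⟩
    have hpa : x * w * (a * w) * a = a := by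
      calc _ = x * (w * a) ^ 2 := by noncomm_ring
        _ = _ := ha
    have hs : star (a * w * (x * w)) = x * w * (a * w) := by
      simpa only [mul_assoc] using h
    have hc := commute_of_star_mul_eq_of_left (by rw [← mul_assoc, hpa]) hs
    have hq : a * w * (x * w) * a = a := by rw [hc, hpa]
    refine ⟨x * w * (x * w) * a, ?_, ?_⟩
    · calc _ = a * w * (a * w * (x * w)) * (x * w * a) := by noncomm_ring
        _ = a * w * (x * w * (a * w)) * (x * w * a) := by rw [hc]
        _ = a * w * (x * w) * (a * w * (x * w) * a) := by noncomm_ring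
        _ = a := by rw [hq, hq]
    · rw [mul_sq_mul_mul_eq hpa hc, sq_mul_mul_mul_eq hpa, hs]
  tfae_have 3 → 2 := by
    rintro ⟨x, ha, h⟩
    have hb : a * w * (a * w * (x * w)) = a * w := by
      calc _ = (a * w) ^ 2 * x * w := by noncomm_ring
        _ = _ := by rw [ha]
    have hs : star (a * w * (x * w)) = x * w * (a * w) := by
      simpa only [mul_assoc] using h
    have hc := commute_of_star_mul_eq_of_right hb hs
    refine ⟨x, ?_, h⟩
    calc _ = x * w * (a * w) * a := by noncomm_ring
      _ = a * w * (x * w) * ((a * w) ^ 2 * x) := by rw [hc, ha]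
      _ = a * w * (x * w * (a * w)) * (a * w * x) := by noncomm_ring
      _ = a * w * (a * w * (x * w)) * (a * w * x) := by rw [hc]
      _ = a := by rw [hb, ← mul_assoc, ← sq, ha]
  tfae_finish
end

section
/- Let a, w, x ∈ 𝒜 satisfy a(wx)² = x, x(wa)² = a, (awxw)* = awxw, and (xwaw)* = xwaw (that is, x witnesses that a is w-EP). Then xwawx = x. -/
variable {A : Type*} [NormedRing A] [StarRing A] [NormedAlgebra ℂ A] [CompleteSpace A]

theorem stmt_5 (a w x : A)
    (h1 : a * (w * x) ^ 2 = x) (h2 : x * (w * a) ^ 2 = a)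
    (h3 : star (a * w * x * w) = a * w * x * w)
    (h4 : star (x * w * a * w) = x * w * a * w) :
    x * w * a * w * x = x := by
  calc
    x * w * a * w * x = x * w * a * w * (a * (w * x) ^ 2) := by rw [h1]
    _ = x * (w * a) ^ 2 * (w * x) ^ 2 := by simp only [pow_two, mul_assoc]
    _ = x := by rw [h2, h1]
end

section
/- Let a, w ∈ 𝒜. Then a is generalized w-EP if and only if there exist x, y ∈ 𝒜 such that a = x + y, x*y = 0, ywx = 0, x is w-EP, and yw is quasinilpotent. -/
variable {A : Type*} [NormedRing A] [StarRing A] [NormedAlgebra ℂ A] [CompleteSpace A]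

open Filter Topology in
/-- If `‖d n‖ ^ (1 / n) → 0`, an element equal to `d n * c ^ n` for all `n ≥ 1` vanishes. -/
theorem eq_zero_of_eq_mul_pow {R : Type*} [NormedRing R] {d : ℕ → R} {c e : R}
    (hd : Tendsto (fun n : ℕ => ‖d n‖ ^ (1 / (n : ℝ))) atTop (𝓝 0))
    (he : ∀ n : ℕ, 1 ≤ n → e = d n * c ^ n) : e = 0 := by
  have hlim : Tendsto (fun n : ℕ => ‖d n‖ ^ (1 / (n : ℝ)) * ‖c‖) atTop (𝓝 0) := by
    simpa using hd.mul_const ‖c‖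
  have hsmall : ∀ᶠ n : ℕ in atTop, ‖e‖ ≤ (1 / 2 : ℝ) ^ n := by
    filter_upwards [hlim.eventually_le_const (show (0 : ℝ) < 1 / 2 by norm_num),
      eventually_ge_atTop 1] with n hn hn1
    have hroot : (‖d n‖ ^ (1 / (n : ℝ))) ^ n = ‖d n‖ := by
      rw [one_div]
      exact Real.rpow_inv_natCast_pow (norm_nonneg _) (by omega)
    calc ‖e‖ = ‖d n * c ^ n‖ := by rw [← he n hn1]
      _ ≤ ‖d n‖ * ‖c ^ n‖ := norm_mul_le _ _
      _ ≤ ‖d n‖ * ‖c‖ ^ n := by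
        gcongr
        exact norm_pow_le' c hn1
      _ = (‖d n‖ ^ (1 / (n : ℝ)) * ‖c‖) ^ n := by rw [mul_pow, hroot]
      _ ≤ (1 / 2 : ℝ) ^ n := by gcongr
  exact norm_le_zero_iff.mp (ge_of_tendsto
    (tendsto_pow_atTop_nhds_zero_of_lt_one (by norm_num) (by norm_num)) hsmall)

theorem mul_eq_pow_mul_pow {R : Type*} [Monoid R] {b c : R} (h : b * (c * c) = c) {n : ℕ}
    (hn : 1 ≤ n) : b * c = b ^ n * c ^ n := by
  induction n, hn using Nat.le_induction with
  | base => simp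
  | succ n hn ih =>
    obtain ⟨k, rfl⟩ := Nat.exists_eq_add_of_le hn
    rw [ih, add_comm 1 k, pow_succ b (k + 1), pow_succ' c (k + 1), pow_succ' c k, mul_assoc,
      ← mul_assoc c c, ← mul_assoc b, h]

/-- If `b * c` and `c * b` are selfadjoint, each absorbing the other on the left, they agree. -/
theorem mul_comm_of_selfAdjoint_mul {R : Type*} [Semigroup R] [StarMul R] {b c : R}
    (hbc : star (b * c) = b * c) (hcb : star (c * b) = c * b)
    (h₁ : b * c * (c * b) = c * b) (h₂ : c * b * (b * c) = b * c) : b * c = c * b := by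
  have h := congrArg star h₁
  rw [star_mul, hbc, hcb, h₂] at h
  exact h

/-- The powers of `(1 - p) * b` for an idempotent `p` commuting with `b`. -/
theorem one_sub_mul_pow {R : Type*} [Ring R] {p b : R} (hp : p * p = p) (hpb : p * b = b * p)
    {n : ℕ} (hn : 1 ≤ n) : ((1 - p) * b) ^ n = (1 - p) * b ^ n := by
  have hc : Commute (1 - p) b := (Commute.one_left b).sub_left hpb
  have hi : IsIdempotentElem (1 - p) := IsIdempotentElem.one_sub hp
  rw [hc.mul_pow, hi.pow_eq (by omega)]

/-- The compression of `(b + q) ^ n` to the complement of `p` is `q ^ n`. -/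
theorem one_sub_mul_add_pow {R : Type*} [Ring R] {p b q : R} (hb : p * b = b) (hq : p * q = 0)
    (hqb : q * b = 0) {n : ℕ} (hn : 1 ≤ n) : (1 - p) * (b + q) ^ n = q ^ n := by
  induction n, hn using Nat.le_induction with
  | base => rw [pow_one, pow_one, sub_mul, one_mul, mul_add, hb, hq]; abel
  | succ n hn ih =>
    obtain ⟨k, rfl⟩ := Nat.exists_eq_add_of_le' hn
    rw [pow_succ, ← mul_assoc, ih, mul_add, ← pow_succ, pow_succ q k, mul_assoc, hqb, mul_zero,
      zero_add]

theorem stmt_7 (a w : A) :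
    IsGenWEP w a ↔
      ∃ x y : A, a = x + y ∧ star x * y = 0 ∧ y * w * x = 0 ∧
        IsWEP w x ∧ IsQuasinilpotent (y * w) := by
  constructor
  · rintro ⟨x, hx, hs₁, hs₂, hlim⟩
    obtain ⟨b, hb⟩ : ∃ b, b = a * w := ⟨_, rfl⟩
    obtain ⟨c, hc⟩ : ∃ c, c = x * w := ⟨_, rfl⟩
    have hbcx : b * (c * x) = x := by rw [hb, hc, ← mul_assoc]; simpa [pow_two, mul_assoc] using hx
    have hbcc : b * (c * c) = c := by
      conv_rhs => rw [hc, ← hbcx]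
      simp only [hc, mul_assoc]
    have hbc : star (b * c) = b * c := by simpa [hb, hc, mul_assoc] using hs₁
    have hcb : star (c * b) = c * b := by simpa [hb, hc, mul_assoc] using hs₂
    rw [← hb, ← hc] at hlim
    have hcbbc : c * b * (b * c) = b * c := by
      have h : b * c - c * b * (b * c) = 0 := by
        refine eq_zero_of_eq_mul_pow (c := c) hlim fun n hn => ?_
        rw [mul_eq_pow_mul_pow hbcc hn, sub_mul, pow_succ' b n]
        simp only [mul_assoc]
      exact (sub_eq_zero.mp h).symm
    have hbccb : b * c * (c * b) = c * b := by
      rw [← mul_assoc, mul_assoc b c c, hbcc]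
    have hcomm : b * c = c * b := mul_comm_of_selfAdjoint_mul hbc hcb hbccb hcbbc
    obtain ⟨p, hp⟩ : ∃ p, p = b * c := ⟨_, rfl⟩
    have hpp : p * p = p := by
      rw [hp]; nth_rw 1 [hcomm]; exact hcbbc
    have hpb : p * b = b * p := by rw [hp]; nth_rw 2 [hcomm]; rw [mul_assoc]
    have hpc : c * p = c := by rw [hp, hcomm, ← mul_assoc, ← hbcc]; grind
    have hps : star p = p := by rw [hp, hbc]
    refine ⟨p * a, a - p * a, by abel, ?_, ?_, ⟨x, ?_, ?_, ?_, ?_⟩, ?_⟩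
    · rw [star_mul, hps, mul_assoc, mul_sub, ← mul_assoc p p, hpp, sub_self, mul_zero]
    · calc (a - p * a) * w * (p * a) = (b * p - p * (b * p)) * a := by rw [hb]; noncomm_ring
        _ = 0 := by rw [← hpb, ← mul_assoc p p, hpp, sub_self, zero_mul]
    · calc p * a * (w * x) ^ 2 = p * (b * (c * x)) := by rw [hb, hc]; noncomm_ring
        _ = x := by rw [hbcx, hp, mul_assoc, hbcx]
    · calc x * (w * (p * a)) ^ 2 = c * p * b * p * a := by rw [hb, hc]; noncomm_ring
        _ = p * a := by rw [hpc, ← hcomm, ← hp, hpp]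
    · have h : p * a * w * x * w = p := by
        calc p * a * w * x * w = p * (b * c) := by rw [hb, hc]; noncomm_ring
          _ = p := by rw [← hp, hpp]
      rw [h, hps]
    · have h : x * w * (p * a) * w = p := by
        calc x * w * (p * a) * w = c * p * b := by rw [hb, hc]; noncomm_ring
          _ = p := by rw [hpc, hp, hcomm]
      rw [h, hps]
    · refine hlim.congr' ?_
      filter_upwards [Filter.eventually_ge_atTop 1] with n hn
      have h : (a - p * a) * w = (1 - p) * b := by rw [hb]; noncomm_ring
      rw [h, one_sub_mul_pow hpp hpb hn, hp, hcomm, sub_mul, one_mul, pow_succ', mul_assoc c b]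
  · rintro ⟨x, y, rfl, hxy, hyx, ⟨z, hz, hx, hs₁, hs₂⟩, hq⟩
    obtain ⟨b, hb⟩ : ∃ b, b = x * w := ⟨_, rfl⟩
    obtain ⟨c, hc⟩ : ∃ c, c = z * w := ⟨_, rfl⟩
    have hbcz : b * (c * z) = z := by rw [hb, hc, ← mul_assoc]; simpa [pow_two, mul_assoc] using hz
    have hcbx : c * (b * x) = x := by rw [hb, hc, ← mul_assoc]; simpa [pow_two, mul_assoc] using hx
    have hbcc : b * (c * c) = c := by
      conv_rhs => rw [hc, ← hbcz]
      simp only [hc, mul_assoc]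
    have hcbb : c * (b * b) = b := by
      conv_rhs => rw [hb, ← hcbx]
      simp only [hb, mul_assoc]
    have hbc : star (b * c) = b * c := by simpa [hb, hc, mul_assoc] using hs₁
    have hcb : star (c * b) = c * b := by simpa [hb, hc, mul_assoc] using hs₂
    have hbccb : b * c * (c * b) = c * b := by rw [← mul_assoc, mul_assoc b c c, hbcc]
    have hcbbc : c * b * (b * c) = b * c := by rw [← mul_assoc, mul_assoc c b b, hcbb]
    have hcomm : b * c = c * b := mul_comm_of_selfAdjoint_mul hbc hcb hbccb hcbbc
    have hcbc : c * (b * c) = c := by rw [← mul_assoc, ← hcomm, mul_assoc, hbcc]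
    have hbcy : b * c * y = 0 := by
      rw [← hbc, hb, mul_assoc x, star_mul, mul_assoc, hxy, mul_zero]
    have hcy : c * y = 0 := by rw [← hcbc, mul_assoc, hbcy, mul_zero]
    have hywz : y * w * z = 0 := by
      calc y * w * z = y * w * x * (w * (c * z)) := by
            conv_lhs => rw [← hbcz, hb]
            noncomm_ring
        _ = 0 := by rw [hyx, zero_mul]
    have h₁ : (x + y) * w * z * w = b * c := by
      calc (x + y) * w * z * w = b * c + y * w * z * w := by rw [hb, hc]; noncomm_ring
        _ = b * c := by rw [hywz, zero_mul, add_zero]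
    have h₂ : z * w * (x + y) * w = c * b := by
      calc z * w * (x + y) * w = c * b + c * y * w := by rw [hb, hc]; noncomm_ring
        _ = c * b := by rw [hcy, zero_mul, add_zero]
    refine ⟨z, ?_, by rw [h₁, hbc], by rw [h₂, hcb], ?_⟩
    · calc (x + y) * (w * z) ^ 2 = b * (c * z) + y * w * z * (w * z) := by
            rw [hb, hc]; noncomm_ring
        _ = z := by rw [hywz, zero_mul, add_zero, hbcz]
    · refine Filter.Tendsto.congr' ?_ hq
      filter_upwards [Filter.eventually_ge_atTop 1] with n hn
      have h : (1 - c * b) * (b + y * w) ^ n = (y * w) ^ n := by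
        refine one_sub_mul_add_pow (by rw [mul_assoc, hcbb]) ?_ ?_ hn
        · rw [← hcomm, ← mul_assoc, hbcy, zero_mul]
        · rw [hb, ← mul_assoc, hyx, zero_mul]
      rw [← h, pow_succ' ((x + y) * w), ← mul_assoc (z * w), ← mul_assoc (z * w), h₂, add_mul x y w,
        ← hb, sub_mul, one_mul]
end

section
/- Let a, w ∈ 𝒜. Then a is generalized w-EP if and only if there exists x ∈ 𝒜 such that a(wx)² = x, (awxw)* = xwaw, and aw − xw(aw)² is quasinilpotent. -/
open Filter Topology in
/-- If `‖e n‖ ^ (1 / n) → 0` and `z = e n * y ^ n` for all `n ≥ 1`, then `z = 0`. -/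
theorem eq_zero_of_forall_eq_mul_pow {R : Type*} [NormedRing R] {e : ℕ → R} {y z : R}
    (he : Tendsto (fun n : ℕ => ‖e n‖ ^ (1 / (n : ℝ))) atTop (𝓝 0))
    (hz : ∀ n : ℕ, 1 ≤ n → z = e n * y ^ n) : z = 0 := by
  have hM : 0 < 2 * (‖y‖ + 1) := by positivity
  have hev : ∀ᶠ n : ℕ in atTop, ‖z‖ ≤ (1 / 2 : ℝ) ^ n := by
    filter_upwards [he.eventually_lt_const (inv_pos.2 hM), eventually_ge_atTop 1] with n hn h1
    have hn0 : n ≠ 0 := by lia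
    have hpow : ‖e n‖ ≤ (2 * (‖y‖ + 1))⁻¹ ^ n := by
      calc ‖e n‖ = (‖e n‖ ^ (1 / (n : ℝ))) ^ n := by
            rw [one_div, Real.rpow_inv_natCast_pow (norm_nonneg _) hn0]
        _ ≤ _ := by gcongr
    calc ‖z‖ = ‖e n * y ^ n‖ := by rw [← hz n h1]
      _ ≤ ‖e n‖ * ‖y ^ n‖ := norm_mul_le _ _
      _ ≤ (2 * (‖y‖ + 1))⁻¹ ^ n * (‖y‖ + 1) ^ n := by
          gcongr
          exact (norm_pow_le' y h1).trans (by gcongr; linarith)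
      _ = (1 / 2 : ℝ) ^ n := by
          rw [← mul_pow]
          congr 1
          field_simp
  have hlim : Tendsto (fun n : ℕ => (1 / 2 : ℝ) ^ n) atTop (𝓝 0) :=
    tendsto_pow_atTop_nhds_zero_of_lt_one (by norm_num) (by norm_num)
  exact norm_le_zero_iff.1 (ge_of_tendsto hlim hev)

theorem pow_mul_pow_eq_of_mul_sq_eq {R : Type*} [Monoid R] {b y : R} (h : b * (y * y) = y)
    {n : ℕ} (hn : 1 ≤ n) : b ^ n * y ^ n = b * y := by
  induction n, hn using Nat.le_induction with
  | base => simp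
  | succ n hn ih =>
    obtain ⟨k, rfl⟩ := Nat.exists_eq_add_of_le' hn
    calc b ^ (k + 1 + 1) * y ^ (k + 1 + 1) = b ^ (k + 1) * (b * (y * y)) * y ^ k := by
          rw [pow_succ b (k + 1), pow_succ' y (k + 1), pow_succ' y k]
          simp only [mul_assoc]
      _ = b ^ (k + 1) * y ^ (k + 1) := by rw [h, mul_assoc, ← pow_succ']
      _ = b * y := ih

/-- If `y` commutes with `b` and `b * y ^ 2 = y`, then `b - y * b ^ 2 = (1 - y * b) * b` with
`1 - y * b` an idempotent commuting with `b`, which determines its powers. -/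
theorem sub_mul_sq_pow {R : Type*} [Ring R] {b y : R} (h : b * (y * y) = y)
    (hc : Commute b y) {n : ℕ} (hn : 1 ≤ n) :
    (b - y * b ^ 2) ^ n = b ^ n - y * b ^ (n + 1) := by
  have hp : IsIdempotentElem (y * b) := by
    calc y * b * (y * b) = b * y * (y * b) := by rw [hc.eq]
      _ = b * (y * y) * b := by simp only [mul_assoc]
      _ = y * b := by rw [h]
  have hcomm : Commute (1 - y * b) b :=
    (Commute.one_left b).sub_left (hc.symm.mul_left (Commute.refl b))
  have hfac : b - y * b ^ 2 = (1 - y * b) * b := by noncomm_ring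
  rw [hfac, hcomm.mul_pow, hp.one_sub.pow_eq (by lia), sub_mul, one_mul, pow_succ', mul_assoc]


variable {A : Type*} [NormedRing A] [StarRing A] [NormedAlgebra ℂ A] [CompleteSpace A]

theorem stmt_8 (a w : A) :
    IsGenWEP w a ↔
      ∃ x : A, a * (w * x) ^ 2 = x ∧ star (a * w * x * w) = x * w * a * w ∧
        IsQuasinilpotent (a * w - x * w * (a * w) ^ 2) := by
  constructor
  · rintro ⟨x, hx, h1, h2, hlim⟩
    have hy : a * w * (x * w * (x * w)) = x * w := by
      calc a * w * (x * w * (x * w)) = a * (w * x) ^ 2 * w := by simp only [sq, mul_assoc]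
        _ = x * w := by rw [hx]
    rw [mul_assoc (a * w) x w] at h1
    rw [mul_assoc (x * w) a w] at h2
    refine ⟨x, hx, ?_⟩
    rw [mul_assoc (a * w) x w, mul_assoc (x * w) a w]
    generalize a * w = b at *
    generalize x * w = y at *
    have hby : b * y - y * b * (b * y) = 0 := by
      refine eq_zero_of_forall_eq_mul_pow (y := y) hlim fun n hn => ?_
      rw [sub_mul, pow_succ', mul_assoc y (b * b ^ n), mul_assoc b,
        pow_mul_pow_eq_of_mul_sq_eq hy hn, mul_assoc]
    have hyb : b * y * (y * b) = y * b := by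
      rw [← mul_assoc, mul_assoc b y y, hy]
    have hc : b * y = y * b := by
      calc b * y = y * b * (b * y) := sub_eq_zero.1 hby
        _ = star (b * y * (y * b)) := by rw [star_mul, h1, h2]
        _ = y * b := by rw [hyb, h2]
    refine ⟨by rw [h1, hc], hlim.congr' ?_⟩
    filter_upwards [Filter.eventually_ge_atTop 1] with n hn
    rw [sub_mul_sq_pow hy hc hn]
  · rintro ⟨x, hx, h1, hlim⟩
    have hy : a * w * (x * w * (x * w)) = x * w := by
      calc a * w * (x * w * (x * w)) = a * (w * x) ^ 2 * w := by simp only [sq, mul_assoc]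
        _ = x * w := by rw [hx]
    rw [mul_assoc (a * w) x w, mul_assoc (x * w) a w] at h1
    refine ⟨x, hx, ?_⟩
    rw [mul_assoc (a * w) x w, mul_assoc (x * w) a w]
    generalize a * w = b at *
    generalize x * w = y at *
    have h2 : star (y * b) = b * y := by rw [← h1, star_star]
    have hyb : b * y * (y * b) = y * b := by
      rw [← mul_assoc, mul_assoc b y y, hy]
    have hc : b * y = y * b := by
      calc b * y = star (b * y * (y * b)) := by rw [hyb, h2]
        _ = y * b := by rw [star_mul, h1, h2, hyb]
    refine ⟨by rw [h1, hc], by rw [h2, hc], Filter.Tendsto.congr' ?_ hlim⟩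
    filter_upwards [Filter.eventually_ge_atTop 1] with n hn
    rw [sub_mul_sq_pow hy hc hn]
end

section
/- Let a, w ∈ 𝒜. Then a is generalized w-EP if and only if there exists a projection p ∈ 𝒜 (i.e., p² = p = p*) such that aw + p is invertible in 𝒜, 1 − p ∈ 𝒜w (i.e., 1 − p = cw for some c ∈ 𝒜), awp = paw, and awp is quasinilpotent. -/
variable {A : Type*} [NormedRing A] [StarRing A] [NormedAlgebra ℂ A] [CompleteSpace A]

open Filter Topology

/-- If `‖f n‖ ^ (1 / n) → 0`, then `f n * z ^ n → 0` for every `z`. -/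
theorem tendsto_mul_pow_of_root_norm_tendsto_zero {R : Type*} [NormedRing R] {f : ℕ → R}
    (hf : Tendsto (fun n : ℕ => ‖f n‖ ^ (1 / (n : ℝ))) atTop (𝓝 0)) (z : R) :
    Tendsto (fun n : ℕ => f n * z ^ n) atTop (𝓝 0) := by
  have hz : 0 < ‖z‖ + 1 := by positivity
  have hε : (0 : ℝ) < 1 / 2 / (‖z‖ + 1) := by positivity
  have hhalf : Tendsto (fun n : ℕ => (1 / 2 : ℝ) ^ n) atTop (𝓝 0) :=
    tendsto_pow_atTop_nhds_zero_of_lt_one (by norm_num) (by norm_num)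
  refine squeeze_zero_norm' ?_ hhalf
  filter_upwards [hf.eventually_lt_const hε, eventually_ge_atTop 1] with n hn hn1
  have hfn : ‖f n‖ ≤ (1 / 2 / (‖z‖ + 1)) ^ n := by
    have h := pow_le_pow_left₀ (by positivity) hn.le n
    rwa [one_div (n : ℝ), Real.rpow_inv_natCast_pow (norm_nonneg _) (by lia)] at h
  calc ‖f n * z ^ n‖ ≤ ‖f n‖ * ‖z ^ n‖ := norm_mul_le _ _
    _ ≤ (1 / 2 / (‖z‖ + 1)) ^ n * (‖z‖ + 1) ^ n := by
        gcongr
        exact (norm_pow_le' z hn1).trans (by gcongr; linarith)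
    _ = (1 / 2) ^ n := by rw [← mul_pow, div_mul_cancel₀ _ hz.ne']

/-- `1 + q` is invertible for quasinilpotent `q`. -/
theorem isUnit_one_add_of_root_norm_tendsto_zero {R : Type*} [NormedRing R] [CompleteSpace R]
    {q : R} (hq : Tendsto (fun n : ℕ => ‖q ^ n‖ ^ (1 / (n : ℝ))) atTop (𝓝 0)) :
    IsUnit (1 + q) := by
  have h := (tendsto_mul_pow_of_root_norm_tendsto_zero hq (-1)).norm
  rw [norm_zero] at h
  obtain ⟨n, hn⟩ := (h.eventually_lt_const one_pos).exists
  have hn' : ‖(-q) ^ n‖ < 1 := by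
    have : (-q) ^ n = q ^ n * (-1) ^ n := by
      rw [← (Commute.neg_one_right q).mul_pow, mul_neg_one]
    rwa [this]
  have hu : IsUnit (1 - (-q) ^ n) := isUnit_one_sub_of_norm_lt_one hn'
  have hcomm : Commute (1 - (-q)) (∑ i ∈ Finset.range n, (-q) ^ i) :=
    (mul_neg_geom_sum (-q) n).trans (geom_sum_mul_neg (-q) n).symm
  rw [← mul_neg_geom_sum, hcomm.isUnit_mul_iff, sub_neg_eq_add] at hu
  exact hu.1

/-- A power of `b * p`, for an idempotent `p` commuting with `b`. -/
theorem mul_pow_of_commute_idempotent {M : Type*} [Monoid M] {b p : M} (hb : Commute b p)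
    (hp : IsIdempotentElem p) {n : ℕ} (hn : n ≠ 0) : (b * p) ^ n = b ^ n * p := by
  rw [hb.mul_pow, hp.pow_eq hn]

theorem pow_mul_pow_of_mul_sq_eq {M : Type*} [Monoid M] {b y : M} (h : b * y ^ 2 = y) (n : ℕ) :
    b ^ (n + 1) * y ^ (n + 1) = b * y := by
  induction n with
  | zero => simp
  | succ k ih =>
    calc b ^ (k + 2) * y ^ (k + 2) = b ^ (k + 1) * (b * y ^ 2) * y ^ k := by
          rw [pow_succ b (k + 1), add_comm k 2, pow_add y 2 k]; simp only [mul_assoc]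
      _ = b * y := by rw [h, mul_assoc, ← pow_succ', ih]

/-- If `b * y ^ 2 = y` and `b ^ n - y * b ^ (n + 1)` is asymptotically negligible, then
`y * b` fixes `b * y`. -/
theorem mul_eq_of_root_norm_tendsto_zero {R : Type*} [NormedRing R] {b y : R}
    (h : b * y ^ 2 = y)
    (hlim : Tendsto (fun n : ℕ => ‖b ^ n - y * b ^ (n + 1)‖ ^ (1 / (n : ℝ))) atTop (𝓝 0)) :
    y * b * (b * y) = b * y := by
  have ht := tendsto_mul_pow_of_root_norm_tendsto_zero hlim y
  have hconst : (fun n : ℕ => (b ^ n - y * b ^ (n + 1)) * y ^ n) =ᶠ[atTop]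
      fun _ => b * y - y * b * (b * y) := by
    filter_upwards [eventually_ge_atTop 1] with n hn
    obtain ⟨k, rfl⟩ := Nat.exists_eq_add_of_le' hn
    rw [sub_mul, pow_mul_pow_of_mul_sq_eq h, pow_succ' b (k + 1), mul_assoc y, mul_assoc b,
      pow_mul_pow_of_mul_sq_eq h, mul_assoc y b]
  exact (sub_eq_zero.mp (tendsto_nhds_unique (tendsto_const_nhds.congr' hconst.symm) ht)).symm

/-- If `b` and `y` commute, `b * y ^ 2 = y` and `b * (1 - b * y)` is quasinilpotent, then
`b + (1 - b * y)` is invertible. -/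
theorem isUnit_add_one_sub_mul {R : Type*} [NormedRing R] [CompleteSpace R] {b y : R}
    (hc : Commute b y) (h : b * y ^ 2 = y)
    (hq : Tendsto (fun n : ℕ => ‖(b * (1 - b * y)) ^ n‖ ^ (1 / (n : ℝ))) atTop (𝓝 0)) :
    IsUnit (b + (1 - b * y)) := by
  have hyb : y * b = b * y := hc.eq.symm
  have hyy : b * (y * y) = y := by rw [← sq, h]
  have hyb' (z : R) : y * (b * z) = b * (y * z) := by
    rw [← mul_assoc, hyb, mul_assoc]
  have hfac : b + (1 - b * y) = (b * (b * y) + (1 - b * y)) * (1 + b * (1 - b * y)) := by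
    simp only [mul_add, add_mul, mul_sub, sub_mul, mul_one, one_mul, mul_assoc, hyb, hyb', hyy]
    abel
  rw [hfac]
  refine IsUnit.mul ?_ (isUnit_one_add_of_root_norm_tendsto_zero hq)
  refine ⟨⟨b * (b * y) + (1 - b * y), y + (1 - b * y), ?_, ?_⟩, rfl⟩ <;>
  · simp only [mul_add, add_mul, mul_sub, sub_mul, mul_one, one_mul, mul_assoc, hyb', hyy]
    abel

theorem stmt_9 (a w : A) :
    IsGenWEP w a ↔
      ∃ p : A, p ^ 2 = p ∧ star p = p ∧ IsUnit (a * w + p) ∧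
        (∃ c : A, 1 - p = c * w) ∧ a * w * p = p * (a * w) ∧
        IsQuasinilpotent (a * w * p) := by
  constructor
  · rintro ⟨x, hx, hs1, hs2, hlim⟩
    have hy : a * w * (x * w) ^ 2 = x * w := by
      conv_rhs => rw [← hx]
      simp only [sq, mul_assoc]
    have hfix := mul_eq_of_root_norm_tendsto_zero hy hlim
    have hs1' : star (a * w * (x * w)) = a * w * (x * w) := by simpa only [mul_assoc] using hs1
    have hs2' : star (x * w * (a * w)) = x * w * (a * w) := by simpa only [mul_assoc] using hs2
    have hxw : x * w * (a * w) = x * w * a * w := by simp only [mul_assoc]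
    generalize a * w = b at *
    generalize x * w = y at *
    have hfix' : b * y * (y * b) = y * b := by
      rw [mul_assoc, ← mul_assoc y y b, ← sq, ← mul_assoc, hy]
    have hc : b * y = y * b := by
      have := congrArg star hfix'
      rw [star_mul, hs1', hs2', hfix] at this
      exact this
    have hidem : IsIdempotentElem (b * y) := by
      have : b * y * (b * y) = b * y := by nth_rewrite 1 [hc]; exact hfix
      exact this
    have hcp : Commute b (1 - b * y) :=
      (Commute.one_right b).sub_right ((Commute.refl b).mul_right hc)
    have hq : IsQuasinilpotent (b * (1 - b * y)) := by
      refine hlim.congr' ?_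
      filter_upwards [eventually_ne_atTop 0] with n hn
      rw [mul_pow_of_commute_idempotent hcp hidem.one_sub hn, mul_sub, mul_one,
        pow_succ, ← mul_assoc y, ← ((show Commute b y from hc).pow_left n).eq, hc, mul_assoc]
    refine ⟨1 - b * y, ?_, ?_, isUnit_add_one_sub_mul hc hy hq, ⟨y * a, ?_⟩, hcp.eq, hq⟩
    · rw [sq]; exact hidem.one_sub
    · rw [star_sub, star_one, hs1']
    · rw [sub_sub_cancel, hc, hxw]
  · rintro ⟨p, hp, hsp, ⟨u, hu⟩, ⟨c, hcw⟩, hcomm, hq⟩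
    have hpp : IsIdempotentElem p := by rw [IsIdempotentElem, ← sq, hp]
    have hxw : (↑u⁻¹ * (1 - p) * c) * w = ↑u⁻¹ * (1 - p) := by
      rw [mul_assoc, ← hcw, mul_assoc, hpp.one_sub.eq]
    have hup : Commute (u : A) (1 - p) := by
      rw [hu]
      exact (Commute.one_right _).sub_right
        (Commute.add_left (show Commute (a * w) p from hcomm) (Commute.refl p))
    have hup' : Commute (↑u⁻¹ : A) (1 - p) := hup.units_inv_left
    have hb1 : a * w * (1 - p) = u * (1 - p) := by
      rw [hu, add_mul, mul_sub p, mul_one, hpp.eq, sub_self, add_zero]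
    have hb2 : (1 - p) * (a * w) = (1 - p) * u := by
      rw [hu, mul_add, sub_mul 1 p p, one_mul, hpp.eq, sub_self, add_zero]
    have hby : a * w * (↑u⁻¹ * (1 - p)) = 1 - p := by
      rw [hup'.eq, ← mul_assoc, hb1, hup.eq, mul_assoc, Units.mul_inv, mul_one]
    have hyb : ↑u⁻¹ * (1 - p) * (a * w) = 1 - p := by
      rw [mul_assoc, hb2, ← hup.eq, Units.inv_mul_cancel_left]
    have hs : star (1 - p) = 1 - p := by rw [star_sub, star_one, hsp]
    refine ⟨↑u⁻¹ * (1 - p) * c, ?_, ?_, ?_, ?_⟩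
    · calc a * (w * (↑u⁻¹ * (1 - p) * c)) ^ 2
          = a * w * (↑u⁻¹ * (1 - p) * c * w) * (↑u⁻¹ * (1 - p) * c) := by
            simp only [sq, mul_assoc]
        _ = ↑u⁻¹ * (1 - p) * c := by
            rw [hxw, hby, hup'.eq, ← mul_assoc, ← mul_assoc, hpp.one_sub.eq]
    · rw [mul_assoc _ _ w, hxw, hby, hs]
    · rw [hxw, mul_assoc _ a w, hyb, hs]
    · refine hq.congr' ?_
      filter_upwards [eventually_ne_atTop 0] with n hn
      rw [mul_pow_of_commute_idempotent hcomm hpp hn, hxw, pow_succ', ← mul_assoc _ (a * w),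
        hyb, sub_mul, one_mul, sub_sub_cancel, ((show Commute (a * w) p from hcomm).pow_left n).eq]
end

section
/- Let a, w ∈ 𝒜. Then a is generalized w-EP if and only if there exists x ∈ 𝒜 such that (awxw)* = awxw, awxw = xwaw, and aw − xw(aw)² is quasinilpotent. -/
variable {A : Type*} [NormedRing A] [StarRing A] [NormedAlgebra ℂ A] [CompleteSpace A]

open Filter Topology

set_option linter.unusedSectionVars false

theorem tendsto_root_zero_iff {f : ℕ → ℝ} (hf : ∀ n, 0 ≤ f n) :
    Tendsto (fun n : ℕ => f n ^ (1 / (n : ℝ))) atTop (𝓝 0) ↔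
      ∀ ε : ℝ, 0 < ε → ∀ᶠ n in atTop, f n ≤ ε ^ n := by
  constructor
  · intro h ε hε
    filter_upwards [h.eventually (gt_mem_nhds hε), eventually_ge_atTop 1] with n hn hn1
    have hn0 : n ≠ 0 := by omega
    have := pow_le_pow_left₀ (Real.rpow_nonneg (hf n) _) hn.le n
    rwa [one_div, Real.rpow_inv_natCast_pow (hf n) hn0] at this
  · intro h
    rw [Metric.tendsto_nhds]
    intro ε hε
    filter_upwards [h (ε / 2) (half_pos hε), eventually_ge_atTop 1] with n hn hn1
    have hn0 : n ≠ 0 := by omega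
    have h1 : f n ^ (1 / (n : ℝ)) ≤ ε / 2 := by
      rw [one_div, ← Real.pow_rpow_inv_natCast (half_pos hε).le hn0]
      exact Real.rpow_le_rpow (hf n) hn (by positivity)
    rw [Real.dist_eq, sub_zero, abs_of_nonneg (Real.rpow_nonneg (hf n) _)]
    linarith

theorem isQuasinilpotent_iff {q : A} :
    IsQuasinilpotent q ↔ ∀ ε : ℝ, 0 < ε → ∀ᶠ n in atTop, ‖q ^ n‖ ≤ ε ^ n :=
  tendsto_root_zero_iff fun _ => norm_nonneg _

theorem IsQuasinilpotent.commute_mul {s q : A} (hq : IsQuasinilpotent q) (h : Commute s q) :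
    IsQuasinilpotent (s * q) := by
  rw [isQuasinilpotent_iff] at hq ⊢
  intro ε hε
  have hs : 0 < ‖s‖ + 1 := by positivity
  filter_upwards [hq (ε / (‖s‖ + 1)) (by positivity), eventually_ge_atTop 1] with n hn hn1
  rw [h.mul_pow]
  calc ‖s ^ n * q ^ n‖ ≤ ‖s ^ n‖ * ‖q ^ n‖ := norm_mul_le _ _
    _ ≤ (‖s‖ + 1) ^ n * (ε / (‖s‖ + 1)) ^ n := by
      gcongr
      exact (norm_pow_le' s hn1).trans (by gcongr; linarith)
    _ = ε ^ n := by rw [← mul_pow, mul_div_cancel₀ _ hs.ne']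

theorem IsQuasinilpotent.isUnit_one_sub {q : A} (hq : IsQuasinilpotent q) : IsUnit (1 - q) := by
  obtain ⟨n, hn, hn1⟩ :=
    ((isQuasinilpotent_iff.1 hq (1 / 2) (by norm_num)).and (eventually_ge_atTop 1)).exists
  have hlt : ‖q ^ n‖ < 1 := hn.trans_lt (pow_lt_one₀ (by norm_num) (by norm_num) (by omega))
  have hu := isUnit_one_sub_of_norm_lt_one hlt
  rw [← mul_neg_geom_sum] at hu
  refine ((Commute.isUnit_mul_iff ?_).1 hu).1
  exact Commute.sum_right _ _ _ fun i _ =>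
    ((Commute.one_left q).sub_left (Commute.refl q)).pow_right i

/-- The generating function of the Catalan numbers can be evaluated at a quasinilpotent element. -/
theorem IsQuasinilpotent.exists_eq_one_add_mul_sq {q : A} (hq : IsQuasinilpotent q) :
    ∃ c : A, c = 1 + q * (c * c) ∧ ∀ s, Commute s q → Commute s c := by
  set f : ℕ → A := fun n => (catalan n : A) * q ^ n with hf
  have hsum : Summable fun n => ‖f n‖ := by
    have hg : Summable fun n : ℕ => ‖(1 : A)‖ * (1 / 2 : ℝ) ^ n :=
      (summable_geometric_of_lt_one (by norm_num) (by norm_num)).mul_left _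
    refine Summable.of_norm_bounded_eventually_nat hg ?_
    filter_upwards [isQuasinilpotent_iff.1 hq (1 / 8) (by norm_num)] with n hn
    have hc : catalan n ≤ 4 ^ n := by
      rw [catalan_eq_centralBinom_div]
      exact (Nat.div_le_self _ _).trans (Nat.centralBinom_le_four_pow n)
    have hc' : ‖(catalan n : A)‖ ≤ 4 ^ n * ‖(1 : A)‖ := by
      rw [← nsmul_one]
      refine (norm_nsmul_le).trans ?_
      gcongr
      exact_mod_cast hc
    rw [norm_norm]
    calc ‖f n‖ ≤ ‖(catalan n : A)‖ * ‖q ^ n‖ := norm_mul_le _ _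
      _ ≤ (4 ^ n * ‖(1 : A)‖) * (1 / 8) ^ n := by gcongr
      _ = ‖(1 : A)‖ * (4 * (1 / 8)) ^ n := by rw [mul_pow]; ring
      _ = ‖(1 : A)‖ * (1 / 2) ^ n := by norm_num
  refine ⟨∑' n, f n, ?_, fun s hs => Commute.tsum_right _ fun n =>
    (Nat.commute_cast s _).mul_right (hs.pow_right n)⟩
  have hprod := summable_norm_sum_mul_antidiagonal_of_summable_norm hsum hsum
  rw [tsum_mul_tsum_eq_tsum_sum_antidiagonal_of_summable_norm hsum hsum,
    ← hprod.of_norm.tsum_mul_left, hsum.of_norm.tsum_eq_zero_add]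
  congr 1
  · simp [hf]
  · congr 1
    ext n
    simp only [hf]
    rw [catalan_succ', Nat.cast_sum, Finset.sum_mul, Finset.mul_sum]
    refine Finset.sum_congr rfl fun ij hij => ?_
    rw [← Finset.HasAntidiagonal.mem_antidiagonal.1 hij, Nat.cast_mul, pow_succ', pow_add]
    have h1 : Commute (catalan ij.1 : A) q := Nat.cast_commute _ _
    have h2 : Commute (catalan ij.2 : A) (q ^ ij.1) := Nat.cast_commute _ _
    have h3 : Commute (catalan ij.2 : A) q := Nat.cast_commute _ _
    calc (catalan ij.1 : A) * catalan ij.2 * (q * (q ^ ij.1 * q ^ ij.2))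
        = catalan ij.1 * (catalan ij.2 * q) * (q ^ ij.1 * q ^ ij.2) := by simp only [mul_assoc]
      _ = (catalan ij.1 * q) * (catalan ij.2 * q ^ ij.1) * q ^ ij.2 := by
        rw [h3.eq]; simp only [mul_assoc]
      _ = q * (catalan ij.1 * q ^ ij.1 * (catalan ij.2 * q ^ ij.2)) := by
        rw [h1.eq, h2.eq]; simp only [mul_assoc]

/-- Idempotents lift modulo quasinilpotents, inside the bicommutant. -/
theorem exists_isIdempotentElem_of_isQuasinilpotent {e : A} (he : IsQuasinilpotent (e - e * e)) :
    ∃ p : A, IsIdempotentElem p ∧ (∀ s, Commute s e → Commute s p) ∧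
      IsQuasinilpotent (p - e) := by
  obtain ⟨c, hc, hcomm⟩ := he.exists_eq_one_add_mul_sq
  set q := e - e * e with hq
  have hq' : ∀ s, Commute s e → Commute s q := fun s hs => hs.sub_right (hs.mul_right hs)
  have hc' : ∀ s, Commute s e → Commute s c := fun s hs => hcomm s (hq' s hs)
  set f := c * q with hfdef
  have hf' : ∀ s, Commute s e → Commute s f := fun s hs => (hc' s hs).mul_right (hq' s hs)
  have hcq : Commute c q := (hcomm q (Commute.refl q)).symm
  have hf : IsQuasinilpotent f := he.commute_mul hcq
  have hff : f - f * f = e - e * e := by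
    have : f * f = (q * (c * c)) * q := by
      rw [hfdef]
      calc c * q * (c * q) = (c * q) * c * q := by simp only [mul_assoc]
        _ = _ := by rw [hcq.eq]; simp only [mul_assoc]
    rw [this, hfdef, ← hq]
    nth_rewrite 1 [hc]
    noncomm_ring
  have hef : Commute e f := hf' e (Commute.refl e)
  obtain ⟨v, hv⟩ : IsUnit (1 - 2 * f) :=
    (hf.commute_mul (Nat.cast_commute 2 f)).isUnit_one_sub
  have hv' : ∀ s, Commute s e → Commute s (↑v⁻¹ : A) := fun s hs => by
    refine Commute.units_inv_right ?_
    rw [hv]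
    exact (Commute.one_right s).sub_right ((Nat.commute_cast s 2).mul_right (hf' s hs))
  have hve : Commute e (↑v⁻¹ : A) := hv' e (Commute.refl e)
  have hvf : Commute f (↑v⁻¹ : A) := (hv' f (hef.symm))
  have hsq : (e - f) * (e - f) = (e - f) * v := by
    rw [hv]
    have := hef.eq
    have h0 : (e - f) * (1 - 2 * f) - (e - f) * (e - f)
        = (e - e * e) - (f - f * f) + (f * e - e * f) := by noncomm_ring
    rw [hff, this, sub_self, sub_self, add_zero] at h0
    exact (sub_eq_zero.1 h0).symm
  refine ⟨(e - f) * ↑v⁻¹, ?_, fun s hs => (hs.sub_right (hf' s hs)).mul_right (hv' s hs), ?_⟩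
  · have hcv : Commute (e - f) (↑v⁻¹ : A) := hve.sub_left hvf
    unfold IsIdempotentElem
    calc (e - f) * ↑v⁻¹ * ((e - f) * ↑v⁻¹) = (e - f) * (↑v⁻¹ * (e - f)) * ↑v⁻¹ := by
          simp only [mul_assoc]
      _ = ((e - f) * (e - f)) * ↑v⁻¹ * ↑v⁻¹ := by rw [← hcv.eq]; simp only [mul_assoc]
      _ = _ := by rw [hsq, mul_assoc (e - f), Units.mul_inv, mul_one]
  · have key : (e - f) * ↑v⁻¹ - e = ((2 * e - 1) * ↑v⁻¹) * f := by
      calc (e - f) * ↑v⁻¹ - e = (e - f) * ↑v⁻¹ - e * (v * ↑v⁻¹) := by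
            rw [Units.mul_inv, mul_one]
        _ = (e - f - e * (1 - 2 * f)) * ↑v⁻¹ := by rw [hv]; noncomm_ring
        _ = (2 * e - 1) * (f * ↑v⁻¹) := by noncomm_ring
        _ = _ := by rw [hvf.eq, mul_assoc]
    rw [key]
    refine hf.commute_mul (Commute.mul_left ?_ hvf.symm)
    exact ((Nat.cast_commute 2 f).mul_left hef).sub_left (Commute.one_left f)

theorem star_eq_of_isIdempotentElem_of_isQuasinilpotent {e p : A} (he : star e = e)
    (hp : IsIdempotentElem p) (hcomm : ∀ s, Commute s e → Commute s p)
    (hq : IsQuasinilpotent (p - e)) : star p = p := by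
  have hunit : ∀ s, Commute s e → IsUnit (1 - s * (p - e)) := fun s hs =>
    (hq.commute_mul ((hcomm s hs).sub_right hs)).isUnit_one_sub
  have hstar : ∀ s, Commute s e → Commute (star s) e := fun s hs => by
    simpa only [he] using hs.star_star
  have hcomm' : ∀ s, Commute s e → Commute s (star p) := fun s hs => by
    simpa only [star_star] using (hcomm _ (hstar s hs)).star_star
  have hpe : Commute p e := (hcomm e (Commute.refl e)).symm
  have hp'e : Commute (star p) e := (hcomm' e (Commute.refl e)).symm
  have hpp' : Commute p (star p) := hcomm' p hpe
  have hp' : star p * star p = star p := by rw [← star_mul, hp.eq]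
  set d := p - star p with hd
  have hde : Commute d e := hpe.sub_left hp'e
  obtain ⟨u, hu⟩ := hunit d hde
  have hue : Commute (↑u⁻¹ : A) e := by
    refine Commute.units_inv_left ?_
    rw [hu]
    exact (Commute.one_left e).sub_left (hde.mul_left (hpe.sub_left (Commute.refl e)))
  have hude : Commute ((↑u⁻¹ : A) * d) e := hue.mul_left hde
  have hu2 : IsUnit (1 + (↑u⁻¹ * d) * (star p - e)) := by
    have h := (hunit (-star (↑u⁻¹ * d)) (hstar _ hude).neg_left).star
    rw [star_sub, star_mul, star_neg, star_star, star_sub, star_one, he, mul_neg,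
      sub_neg_eq_add, ← ((hcomm' _ hude).sub_right hude).eq] at h
    exact h
  have hdd : IsUnit (1 - d * d) := by
    have : 1 - d * d = u * (1 + (↑u⁻¹ * d) * (star p - e)) := by
      rw [mul_add, mul_one, mul_assoc, Units.mul_inv_cancel_left, hu, hd]
      noncomm_ring
    rw [this]
    exact u.isUnit.mul hu2
  have hzero : d * (1 - d * d) = 0 := by
    have hdd' : d * d = p + star p - 2 * (p * star p) := by
      have : d * d = p * p + star p * star p - p * star p - star p * p := by
        rw [hd]; noncomm_ring
      rw [this, hp.eq, hp', ← hpp'.eq]; noncomm_ring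
    have h1 : p * (p * star p) = p * star p := by rw [← mul_assoc, hp.eq]
    have h2 : star p * (p * star p) = p * star p := by
      rw [← mul_assoc, ← hpp'.eq, mul_assoc, hp']
    have e1 : p * (1 - d * d) = p * star p := by
      rw [hdd']
      have : p * (1 - (p + star p - 2 * (p * star p)))
        = p - p * p - p * star p + 2 * (p * (p * star p)) := by noncomm_ring
      rw [this, h1, hp.eq]; noncomm_ring
    have e2 : star p * (1 - d * d) = p * star p := by
      rw [hdd']
      have : star p * (1 - (p + star p - 2 * (p * star p)))
        = star p - star p * p - star p * star p + 2 * (star p * (p * star p)) := by noncomm_ring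
      rw [this, h2, hp', ← hpp'.eq]; noncomm_ring
    rw [hd, sub_mul, ← hd, e1, e2, sub_self]
  have hd0 : d = 0 := (hdd.mul_left_eq_zero).1 hzero
  exact (sub_eq_zero.1 hd0).symm

theorem eq_zero_of_eventually_eq_mul_pow {u : ℕ → A} {c z : A}
    (hu : Tendsto (fun n : ℕ => ‖u n‖ ^ (1 / (n : ℝ))) atTop (𝓝 0))
    (h : ∀ᶠ n in atTop, c = u n * z ^ n) : c = 0 := by
  rw [tendsto_root_zero_iff fun _ => norm_nonneg _] at hu
  have hz : 0 < ‖z‖ + 1 := by positivity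
  have hle : ∀ᶠ n : ℕ in atTop, ‖c‖ ≤ (1 / 2 : ℝ) ^ n := by
    filter_upwards [h, hu (1 / 2 / (‖z‖ + 1)) (by positivity), eventually_ge_atTop 1]
      with n hn hn' hn1
    calc ‖c‖ = ‖u n * z ^ n‖ := by rw [← hn]
      _ ≤ ‖u n‖ * ‖z ^ n‖ := norm_mul_le _ _
      _ ≤ (1 / 2 / (‖z‖ + 1)) ^ n * (‖z‖ + 1) ^ n := by
        gcongr
        exact (norm_pow_le' z hn1).trans (by gcongr; linarith)
      _ = (1 / 2) ^ n := by rw [← mul_pow, div_mul_cancel₀ _ hz.ne']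
  have := ge_of_tendsto
    (tendsto_pow_atTop_nhds_zero_of_lt_one (r := (1 / 2 : ℝ)) (by norm_num) (by norm_num)) hle
  exact norm_le_zero_iff.1 this

theorem pow_succ_mul_pow_succ_of_mul_sq {R : Type*} [Monoid R] {b y : R} (h : b * (y * y) = y)
    (n : ℕ) : b ^ (n + 1) * y ^ (n + 1) = b * y := by
  induction n with
  | zero => simp
  | succ n ih =>
    calc b ^ (n + 2) * y ^ (n + 2) = b ^ (n + 1) * (b * (y * y)) * y ^ n := by
          rw [pow_succ b, pow_succ' y, pow_succ' y]; simp only [mul_assoc]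
      _ = b * y := by rw [h, mul_assoc, ← pow_succ', ih]

theorem sub_mul_sq_pow_succ {R : Type*} [Ring R] {b y : R} (hc : Commute b y)
    (hp : IsIdempotentElem (y * b)) (n : ℕ) :
    (b - y * b ^ 2) ^ (n + 1) = b ^ (n + 1) - y * b ^ (n + 2) := by
  have h1 : b - y * b ^ 2 = (1 - y * b) * b := by noncomm_ring
  have hcb : Commute (1 - y * b) b :=
    (Commute.one_left b).sub_left (hc.symm.mul_left (Commute.refl b))
  rw [h1, hcb.mul_pow, hp.one_sub.pow_succ_eq, sub_mul, one_mul, mul_assoc, ← pow_succ']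

/-- The forward direction, in terms of `b = aw` and `y = xw`. -/
theorem commute_and_isQuasinilpotent_of_mul_sq {b y : A} (h : b * (y * y) = y)
    (h1 : star (b * y) = b * y) (h2 : star (y * b) = y * b)
    (h3 : Tendsto (fun n : ℕ => ‖b ^ n - y * b ^ (n + 1)‖ ^ (1 / (n : ℝ))) atTop (𝓝 0)) :
    b * y = y * b ∧ IsQuasinilpotent (b - y * b ^ 2) := by
  have hpq : (b * y) * (y * b) = y * b := by
    rw [mul_assoc, ← mul_assoc y, ← mul_assoc, h]
  have hqp : b * y - (y * b) * (b * y) = 0 := by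
    refine eq_zero_of_eventually_eq_mul_pow (z := y) h3 ?_
    filter_upwards [eventually_ge_atTop 1] with n hn
    obtain ⟨m, rfl⟩ : ∃ m, n = m + 1 := ⟨n - 1, by omega⟩
    have hm := pow_succ_mul_pow_succ_of_mul_sq h m
    rw [sub_mul, hm, pow_succ' b (m + 1)]
    simp only [mul_assoc, hm]
  have hqp' : (y * b) * (b * y) = y * b := by
    have := congrArg star hpq
    rwa [star_mul, h1, h2] at this
  have hcomm : b * y = y * b := by rw [hqp'] at hqp; exact sub_eq_zero.1 hqp
  refine ⟨hcomm, ?_⟩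
  have hidem : IsIdempotentElem (y * b) := by rwa [hcomm] at hpq
  refine h3.congr' ?_
  filter_upwards [eventually_ge_atTop 1] with n hn
  obtain ⟨m, rfl⟩ : ∃ m, n = m + 1 := ⟨n - 1, by omega⟩
  rw [sub_mul_sq_pow_succ hcomm hidem]

/-- The backward direction, in terms of `b = aw` and `y = xw`. -/
theorem exists_mul_sq_of_isQuasinilpotent {b y : A} (h1 : star (b * y) = b * y)
    (hc : b * y = y * b) (h : IsQuasinilpotent (b - y * b ^ 2)) :
    ∃ z : A, b * (z * z) = z ∧ b * z = z * b ∧ star (b * z) = b * z ∧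
      IsQuasinilpotent (b - z * b ^ 2) := by
  have hby : Commute b y := hc
  set e := b * y with he
  have hbe : Commute b e := (Commute.refl b).mul_right hby
  have hye : Commute y e := hby.symm.mul_right (Commute.refl y)
  have hq1 : b - y * b ^ 2 = (1 - e) * b := by rw [hc]; noncomm_ring
  rw [hq1] at h
  have hqe : IsQuasinilpotent (e - e * e) := by
    have : e - e * e = y * ((1 - e) * b) := by
      rw [← mul_assoc y, ((Commute.one_right y).sub_right hye).eq, mul_assoc (1 - e), ← hc, sub_mul,
        one_mul]
    rw [this]
    exact h.commute_mul (((Commute.one_right y).sub_right hye).mul_right hby.symm)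
  obtain ⟨p, hp, hpc, hpq⟩ := exists_isIdempotentElem_of_isQuasinilpotent hqe
  have hps := star_eq_of_isIdempotentElem_of_isQuasinilpotent h1 hp hpc hpq
  have hpe : Commute p e := (hpc e (Commute.refl e)).symm
  have hbp : Commute b p := hpc b hbe
  have hyp : Commute y p := hpc y hye
  obtain ⟨v, hv⟩ := hpq.isUnit_one_sub
  have hbv : Commute b (↑v⁻¹ : A) := Commute.units_inv_right <| by
    rw [hv]; exact (Commute.one_right b).sub_right (hbp.sub_right hbe)
  have hpv : Commute p (↑v⁻¹ : A) := Commute.units_inv_right <| by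
    rw [hv]; exact (Commute.one_right p).sub_right ((Commute.refl p).sub_right hpe)
  have hpev : p * e = p * v := by
    have : p * (1 - (p - e)) = p - p * p + p * e := by noncomm_ring
    rw [hv, this, hp.eq, sub_self, zero_add]
  set z := p * y * ↑v⁻¹ with hz
  have hbz : Commute b z := (hbp.mul_right hby).mul_right hbv
  have hbzp : b * z = p := by
    calc b * z = (b * p) * y * ↑v⁻¹ := by rw [hz]; simp only [mul_assoc]
      _ = (p * e) * ↑v⁻¹ := by rw [hbp.eq, he]; simp only [mul_assoc]
      _ = p := by rw [hpev, mul_assoc, Units.mul_inv, mul_one]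
  have hpz : p * z = z := by rw [hz, ← mul_assoc, ← mul_assoc, hp.eq]
  refine ⟨z, by rw [← mul_assoc, hbzp, hpz], hbz.eq, by rw [hbzp, hps], ?_⟩
  have hpq' : IsQuasinilpotent (-1 * (p - e)) := hpq.commute_mul (Commute.one_left _).neg_left
  obtain ⟨t, ht⟩ := hpq'.isUnit_one_sub
  have hbt : Commute b (↑t⁻¹ : A) := Commute.units_inv_right <| by
    rw [ht]
    exact (Commute.one_right b).sub_right
      ((Commute.one_right b).neg_right.mul_right (hbp.sub_right hbe))
  have het : Commute e (↑t⁻¹ : A) := Commute.units_inv_right <| by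
    rw [ht]
    exact (Commute.one_right e).sub_right
      ((Commute.one_right e).neg_right.mul_right (hpe.symm.sub_right (Commute.refl e)))
  have hpt : Commute p (↑t⁻¹ : A) := Commute.units_inv_right <| by
    rw [ht]
    exact (Commute.one_right p).sub_right
      ((Commute.one_right p).neg_right.mul_right ((Commute.refl p).sub_right hpe))
  have hprod : (1 - p) * (1 - e) = (1 - p) * t := by
    have e1 : (1 - p) * (1 - -1 * (p - e)) = (1 - p) * (1 - e) + (p - p * p) := by noncomm_ring
    rw [ht, e1, hp.eq, sub_self, add_zero]
  have key : b - z * b ^ 2 = (↑t⁻¹ * (1 - p)) * ((1 - e) * b) := by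
    have e1 : b - z * b ^ 2 = (1 - z * b) * b := by noncomm_ring
    have e2 : Commute (1 - p) (↑t⁻¹ : A) := (Commute.one_left _).sub_left hpt
    rw [e1, ← hbz.eq, hbzp]
    calc (1 - p) * b = ((1 - p) * ↑t⁻¹) * t * b := by rw [Units.inv_mul_cancel_right]
      _ = ↑t⁻¹ * ((1 - p) * t) * b := by rw [e2.eq]; simp only [mul_assoc]
      _ = _ := by rw [← hprod]; simp only [mul_assoc]
  rw [key]
  refine h.commute_mul (Commute.mul_left ?_ ?_)
  · exact ((Commute.one_right _).sub_right het.symm).mul_right hbt.symm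
  · exact (Commute.one_left _).sub_left
      (((Commute.one_right p).sub_right hpe).mul_right hbp.symm)

theorem stmt_10 (a w : A) :
    IsGenWEP w a ↔
      ∃ x : A, star (a * w * x * w) = a * w * x * w ∧
        a * w * x * w = x * w * a * w ∧
        IsQuasinilpotent (a * w - x * w * (a * w) ^ 2) := by
  constructor
  · rintro ⟨x, hx, h1, h2, h3⟩
    have h1' : star (a * w * (x * w)) = a * w * (x * w) := by simpa only [mul_assoc] using h1
    have h2' : star (x * w * (a * w)) = x * w * (a * w) := by simpa only [mul_assoc] using h2
    have hx' : a * w * (x * w * (x * w)) = x * w := by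
      conv_rhs => rw [← hx]
      simp only [pow_two, mul_assoc]
    obtain ⟨hc, hq⟩ := commute_and_isQuasinilpotent_of_mul_sq hx' h1' h2' h3
    exact ⟨x, h1, by simpa only [mul_assoc] using hc, hq⟩
  · rintro ⟨x, h1, hc, hq⟩
    have h1' : star (a * w * (x * w)) = a * w * (x * w) := by simpa only [mul_assoc] using h1
    have hc' : a * w * (x * w) = x * w * (a * w) := by simpa only [mul_assoc] using hc
    obtain ⟨z, hz, hbz, hs, hzq⟩ := exists_mul_sq_of_isQuasinilpotent h1' hc' hq
    have hzw : z * z * a * w = z := by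
      rw [mul_assoc, mul_assoc z, ← hbz, ← mul_assoc, ← hbz, mul_assoc, hz]
    have hidem : IsIdempotentElem (z * (a * w)) := by
      unfold IsIdempotentElem
      calc z * (a * w) * (z * (a * w)) = z * (a * w * z) * (a * w) := by simp only [mul_assoc]
        _ = z * z * (a * w) * (a * w) := by rw [hbz]; simp only [mul_assoc]
        _ = z * (a * w) := by rw [← mul_assoc (z * z), hzw]
    refine ⟨z * z * a, ?_, ?_, ?_, ?_⟩
    · calc a * (w * (z * z * a)) ^ 2 = a * w * (z * z * a * w) * (z * z * a) := by
            simp only [pow_two, mul_assoc]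
        _ = (a * w * (z * z)) * z * a := by rw [hzw]; simp only [mul_assoc]
        _ = z * z * a := by rw [hz]
    · rw [mul_assoc (a * w), hzw, hs]
    · rw [hzw, mul_assoc, ← hbz, hs]
    · refine Tendsto.congr' ?_ hzq
      filter_upwards [eventually_ge_atTop 1] with n hn
      obtain ⟨m, rfl⟩ : ∃ m, n = m + 1 := ⟨n - 1, by omega⟩
      rw [hzw, sub_mul_sq_pow_succ hbz hidem]
end

section
/- Let a, w ∈ 𝒜 with a generalized w-EP, and let x ∈ 𝒜 be its generalized w-EP inverse; in particular x satisfies a(wx)² = x, xwawx = x, awx = xwa, and (awxw)* = awxw. Then x is w-EP, and in fact y := (aw)²x is a w-EP witness for x, i.e., x(wy)² = y, y(wx)² = x, (xwyw)* = xwyw, and (ywxw)* = ywxw. -/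
variable {A : Type*} [NormedRing A] [StarRing A] [NormedAlgebra ℂ A] [CompleteSpace A]

theorem stmt_13 (a w x : A)
    (h1 : a * (w * x) ^ 2 = x)
    (h2 : star (a * w * x * w) = a * w * x * w)
    (h3 : star (x * w * a * w) = x * w * a * w)
    (h4 : Filter.Tendsto
      (fun n : ℕ => ‖(a * w) ^ n - x * w * (a * w) ^ (n + 1)‖ ^ (1 / (n : ℝ)))
      Filter.atTop (nhds 0))
    (h5 : x * w * a * w * x = x)
    (h6 : a * w * x = x * w * a) :
    IsWEP w x ∧
      (x * (w * ((a * w) ^ 2 * x)) ^ 2 = (a * w) ^ 2 * x ∧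
       ((a * w) ^ 2 * x) * (w * x) ^ 2 = x ∧
       star (x * w * ((a * w) ^ 2 * x) * w) = x * w * ((a * w) ^ 2 * x) * w ∧
       star (((a * w) ^ 2 * x) * w * x * w) = ((a * w) ^ 2 * x) * w * x * w) := by
  have hx : a * w * x * w * x = x := by
    simpa only [pow_two, mul_assoc] using h1
  have hxy : x * w * ((a * w) ^ 2 * x) = a * w * x := calc
    x * w * ((a * w) ^ 2 * x) = x * w * a * (w * (a * w * x)) := by
      simp only [pow_two, mul_assoc]
    _ = a * w * x * (w * (a * w * x)) := by rw [← h6]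
    _ = a * w * (x * w * a * w * x) := by simp only [mul_assoc]
    _ = a * w * x := by rw [h5]
  have hyx : (a * w) ^ 2 * x * w * x = a * w * x := calc
    (a * w) ^ 2 * x * w * x = a * w * (a * w * x * w * x) := by
      simp only [pow_two, mul_assoc]
    _ = a * w * x := by rw [hx]
  have hy : x * (w * ((a * w) ^ 2 * x)) ^ 2 = (a * w) ^ 2 * x := calc
    x * (w * ((a * w) ^ 2 * x)) ^ 2
        = x * w * ((a * w) ^ 2 * x) * (w * ((a * w) ^ 2 * x)) := by
      simp only [pow_two, mul_assoc]
    _ = a * w * x * (w * ((a * w) ^ 2 * x)) := by rw [hxy]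
    _ = a * w * (x * w * ((a * w) ^ 2 * x)) := by simp only [mul_assoc]
    _ = (a * w) ^ 2 * x := by rw [hxy]; simp only [pow_two, mul_assoc]
  have hyxx : (a * w) ^ 2 * x * (w * x) ^ 2 = x := calc
    (a * w) ^ 2 * x * (w * x) ^ 2 = (a * w) ^ 2 * x * w * x * w * x := by
      simp only [pow_two, mul_assoc]
    _ = x := by rw [hyx, hx]
  have hsxy : star (x * w * ((a * w) ^ 2 * x) * w) = x * w * ((a * w) ^ 2 * x) * w := by
    rw [hxy, h2]
  have hsyx : star ((a * w) ^ 2 * x * w * x * w) = (a * w) ^ 2 * x * w * x * w := by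
    rw [hyx, h2]
  exact ⟨⟨(a * w) ^ 2 * x, hy, hyxx, hsxy, hsyx⟩, hy, hyxx, hsxy, hsyx⟩
end

section
/- Let a, w ∈ 𝒜. Then a is w-*-DMP if and only if there exist x, y ∈ 𝒜 such that a = x + y, x*y = 0, ywx = 0, x is w-EP, and yw is nilpotent. -/
variable {A : Type*} [NormedRing A] [StarRing A] [NormedAlgebra ℂ A] [CompleteSpace A]

/-- If `a * b ^ 2 = b`, then `b = a ^ k * b ^ (k + 1)` for all `k`. -/
theorem eq_pow_mul_pow_succ {R : Type*} [Monoid R] {a b : R} (h : a * b ^ 2 = b) (k : ℕ) :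
    a ^ k * b ^ (k + 1) = b := by
  induction k with
  | zero => simp
  | succ k ih =>
    calc a ^ (k + 1) * b ^ (k + 1 + 1) = a ^ k * (a * b ^ 2) * b ^ k := by
          rw [pow_succ a, add_assoc, add_comm k, pow_add b (1 + 1)]; simp only [mul_assoc]
      _ = b := by rw [h, mul_assoc, ← pow_succ', ih]

/-- A core-type inverse `b` of `a` satisfies `b * a * b = b`. -/
theorem mul_mul_self_of_pow_eq {R : Type*} [Monoid R] {a b : R} {n : ℕ}
    (h : a * b ^ 2 = b) (hn : a ^ n = b * a ^ (n + 1)) : b * a * b = b := by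
  calc b * a * b = b * a * (a ^ n * b ^ (n + 1)) := by rw [eq_pow_mul_pow_succ h]
    _ = b * a ^ (n + 1) * b ^ (n + 1) := by rw [pow_succ' a]; simp only [mul_assoc]
    _ = b := by rw [← hn, eq_pow_mul_pow_succ h]

/-- A core-type inverse `b` of `a` for which `a * b` and `b * a` are self-adjoint
commutes with `a`. -/
theorem mul_comm_of_star_eq {R : Type*} [Monoid R] [StarMul R] {a b : R} {n : ℕ}
    (h : a * b ^ 2 = b) (hn : a ^ n = b * a ^ (n + 1))
    (hab : star (a * b) = a * b) (hba : star (b * a) = b * a) : a * b = b * a := by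
  have h₁ : a * b * (b * a) = b * a := by
    rw [mul_assoc, ← mul_assoc b, ← pow_two, ← mul_assoc, h]
  have h₂ : b * a * (a * b) = a * b := by
    calc b * a * (a * b) = b * a * a * (a ^ n * b ^ (n + 1)) := by
          rw [eq_pow_mul_pow_succ h]; simp only [mul_assoc]
      _ = b * a ^ (n + 1) * a * b ^ (n + 1) := by
          have : a * (a * a ^ n) = a ^ (n + 1) * a := by
            rw [← pow_succ', ← pow_succ', ← pow_succ]
          simp only [mul_assoc]
          rw [← mul_assoc (a ^ (n + 1)), ← this]
          simp only [mul_assoc]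
      _ = a * (a ^ n * b ^ (n + 1)) := by
          rw [← hn, ← pow_succ, pow_succ', mul_assoc]
      _ = a * b := by rw [eq_pow_mul_pow_succ h]
  have h₃ := congrArg star h₁
  rw [star_mul, hab, hba, h₂] at h₃
  exact h₃

/-- The component `a * w * x * w * a` of a `w`-*-DMP element `a` gives the decomposition. -/
theorem IsWStarDMP.exists_decomposition {B : Type*} [NormedRing B] [StarRing B] {a w : B}
    (h : IsWStarDMP w a) :
    ∃ x y : B, a = x + y ∧ star x * y = 0 ∧ y * w * x = 0 ∧
      IsWEP w x ∧ IsNilpotent (y * w) := by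
  obtain ⟨x, n, hn1, hx, hs₁, hs₂, hn⟩ := h
  have hx' : a * w * (x * w) ^ 2 = x * w := by
    conv_rhs => rw [← hx]
    simp only [pow_two, mul_assoc]
  have hc : a * w * (x * w) = x * w * (a * w) :=
    mul_comm_of_star_eq hx' hn (by simpa only [mul_assoc] using hs₁)
      (by simpa only [mul_assoc] using hs₂)
  have hr : x * w * (a * w) * (x * w) = x * w := mul_mul_self_of_pow_eq hx' hn
  obtain ⟨p, hp⟩ : ∃ p, p = a * w * (x * w) := ⟨_, rfl⟩
  have hps : star p = p := by rw [hp]; simpa only [mul_assoc] using hs₁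
  have hpp : p * p = p := by
    rw [hp, mul_assoc (a * w), ← mul_assoc (x * w), hr]
  have hpa : p * (a * w) = a * w * p := by
    rw [hp, mul_assoc, ← hc]
  have hXp : x * w * p = x * w := by rw [hp, ← mul_assoc, hr]
  have hXA : x * w * (a * w) = p := by rw [hp, hc]
  have hpx : p * x = x := by
    conv_rhs => rw [← hx]
    rw [hp]; simp only [pow_two, mul_assoc]
  have hpA_X : p * a * w * x * w = p := by
    calc p * a * w * x * w = p * (a * w * (x * w)) := by simp only [mul_assoc]
      _ = p := by rw [← hp, hpp]
  have hX_pA : x * w * (p * a) * w = p := by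
    calc x * w * (p * a) * w = x * w * p * (a * w) := by simp only [mul_assoc]
      _ = p := by rw [hXp, hXA]
  refine ⟨p * a, (1 - p) * a, by noncomm_ring, ?_, ?_, ⟨x, ?_, ?_, ?_, ?_⟩, n, ?_⟩
  · calc star (p * a) * ((1 - p) * a) = star a * (p - p * p) * a := by
          rw [star_mul, hps]; noncomm_ring
      _ = 0 := by rw [hpp]; simp
  · calc (1 - p) * a * w * (p * a) = (1 - p) * (a * w * p) * a := by simp only [mul_assoc]
      _ = (p - p * p) * (a * w) * a := by rw [← hpa]; noncomm_ring
      _ = 0 := by rw [hpp]; simp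
  · calc p * a * (w * x) ^ 2 = p * (a * (w * x) ^ 2) := mul_assoc _ _ _
      _ = x := by rw [hx, hpx]
  · calc x * (w * (p * a)) ^ 2 = x * w * (p * a) * w * (p * a) := by
          simp only [pow_two, mul_assoc]
      _ = p * a := by rw [hX_pA, ← mul_assoc, hpp]
  · rw [hpA_X, hps]
  · rw [hX_pA, hps]
  · have hcomm : Commute (1 - p) (a * w) := (Commute.one_left _).sub_left hpa
    have hzero : (1 - p) * (a * w) ^ n = 0 := by
      rw [sub_mul, one_mul, ← hXA, mul_assoc, ← pow_succ', ← hn, sub_self]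
    obtain ⟨m, rfl⟩ : ∃ m, n = m + 1 := ⟨n - 1, by omega⟩
    rw [mul_assoc, hcomm.mul_pow, pow_succ (1 - p), mul_assoc, hzero, mul_zero]

/-- A `w`-EP element plus an orthogonal element `y` with `y * w` nilpotent is `w`-*-DMP. -/
theorem IsWEP.isWStarDMP_add {B : Type*} [NormedRing B] [StarRing B] {w x y : B}
    (hx : IsWEP w x) (hxy : star x * y = 0)
    (hyx : y * w * x = 0) (hy : IsNilpotent (y * w)) : IsWStarDMP w (x + y) := by
  obtain ⟨z, hz, hzx, hs₁, hs₂⟩ := hx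
  obtain ⟨n, hn⟩ := hy
  have hz' : x * w * (z * w) ^ 2 = z * w := by
    conv_rhs => rw [← hz]
    simp only [pow_two, mul_assoc]
  have hX : (x * w) ^ 1 = z * w * (x * w) ^ (1 + 1) := by
    rw [pow_one]
    conv_lhs => rw [← hzx]
    simp only [one_add_one_eq_two, pow_two, mul_assoc]
  have hp₁ : star (x * w * (z * w)) = x * w * (z * w) := by simpa only [mul_assoc] using hs₁
  have hp₂ : star (z * w * (x * w)) = z * w * (x * w) := by simpa only [mul_assoc] using hs₂
  have hc : x * w * (z * w) = z * w * (x * w) := mul_comm_of_star_eq hz' hX hp₁ hp₂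
  have hr : z * w * (x * w) * (z * w) = z * w := mul_mul_self_of_pow_eq hz' hX
  have hyz : y * w * z = 0 := by
    rw [← hz, ← mul_assoc, hyx, zero_mul]
  have hpy : x * w * (z * w) * y = 0 := by
    rw [← hp₁, star_mul, star_mul x w, mul_assoc, mul_assoc, hxy, mul_zero, mul_zero]
  have hzy : z * w * y = 0 := by
    rw [← hr, mul_assoc (z * w), mul_assoc (z * w), hpy, mul_zero]
  have hyX : y * w * (x * w) = 0 := by rw [← mul_assoc, hyx, zero_mul]
  have hpow (k : ℕ) : ((x + y) * w) ^ (k + 1) - z * w * ((x + y) * w) ^ (k + 1 + 1) =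
      (y * w) ^ (k + 1) := by
    induction k with
    | zero =>
      have h₁ : z * w * ((x + y) * w) = z * w * (x * w) := by
        rw [add_mul, mul_add, ← mul_assoc (z * w) y, hzy, zero_mul, add_zero]
      have h₂ : z * w * (x * w) * (x * w) = x * w := by
        rw [mul_assoc, ← pow_two, ← hX, pow_one]
      rw [zero_add, pow_one, pow_one, pow_two, ← mul_assoc, h₁, add_mul x y w, mul_add, h₂, ← hc,
        ← mul_assoc _ y w, hpy, zero_mul]
      abel
    | succ k ih =>
      rw [pow_succ _ (k + 1), pow_succ _ (k + 1 + 1), ← mul_assoc (z * w), ← sub_mul, ih, add_mul, mul_add,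
        pow_succ (y * w) k, mul_assoc _ _ (x * w), hyX, mul_zero, zero_add, ← pow_succ, ← pow_succ]
  refine ⟨z, n + 1, by omega, ?_, ?_, ?_, ?_⟩
  · rw [add_mul, hz, pow_two, ← mul_assoc, ← mul_assoc y, hyz, zero_mul, add_zero]
  · have : (x + y) * w * z * w = x * w * z * w := by
      rw [add_mul, add_mul, hyz, add_zero]
    rw [this, hs₁]
  · have : z * w * (x + y) * w = z * w * x * w := by
      rw [mul_add, hzy, add_zero]
    rw [this, hs₂]
  · rw [← sub_eq_zero, hpow, pow_succ, hn, zero_mul]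

theorem stmt_14 (a w : A) :
    IsWStarDMP w a ↔
      ∃ x y : A, a = x + y ∧ star x * y = 0 ∧ y * w * x = 0 ∧
        IsWEP w x ∧ IsNilpotent (y * w) := by
  refine ⟨IsWStarDMP.exists_decomposition, ?_⟩
  rintro ⟨x, y, rfl, hxy, hyx, hx, hy⟩
  exact hx.isWStarDMP_add hxy hyx hy
end

section
/- Let a, b, w ∈ 𝒜 with a and b both w-*-DMP. If awb = 0, bwa = 0, and a*b = 0, then a + b is w-*-DMP. -/
/-- A solution `x` of `p * x ^ 2 = x` and `p ^ n = x * p ^ (n + 1)` is an outer inverse of `p`. -/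
theorem mul_mul_self_eq_of_pow_eq {M : Type*} [Monoid M] {p x : M} {n : ℕ} (hx : p * x * x = x)
    (hn : p ^ n = x * p ^ (n + 1)) : x * p * x = x := by
  have hk : ∀ k : ℕ, p ^ k * x ^ (k + 1) = x := by
    intro k
    induction k with
    | zero => simp
    | succ k ih =>
      calc p ^ (k + 1) * x ^ (k + 2) = p ^ k * (p * x * x) * x ^ k := by
            rw [pow_succ p, show k + 2 = 1 + 1 + k by omega, pow_add x, pow_add x, pow_one]
            simp only [mul_assoc]
        _ = x := by rw [hx, mul_assoc, ← pow_succ', ih]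
  calc x * p * x = x * p * (p ^ n * x ^ (n + 1)) := by rw [hk]
    _ = x * p ^ (n + 1) * x ^ (n + 1) := by rw [pow_succ' p]; simp only [mul_assoc]
    _ = x := by rw [← hn, hk]

theorem pow_eq_mul_pow_succ_of_le {M : Type*} [Monoid M] {p x : M} {n k : ℕ} (hnk : n ≤ k)
    (hn : p ^ n = x * p ^ (n + 1)) : p ^ k = x * p ^ (k + 1) := by
  obtain ⟨j, rfl⟩ := Nat.exists_eq_add_of_le hnk
  rw [pow_add, hn, mul_assoc, ← pow_add, add_right_comm]

theorem add_pow_of_mul_eq_zero {R : Type*} [Semiring R] {p q : R} (hpq : p * q = 0)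
    (hqp : q * p = 0) (k : ℕ) : (p + q) ^ (k + 1) = p ^ (k + 1) + q ^ (k + 1) := by
  induction k with
  | zero => simp
  | succ k ih =>
    have h1 : p ^ (k + 1) * q = 0 := by rw [pow_succ, mul_assoc, hpq, mul_zero]
    have h2 : q ^ (k + 1) * p = 0 := by rw [pow_succ, mul_assoc, hqp, mul_zero]
    rw [pow_succ, ih, add_mul, mul_add, mul_add, h1, h2, add_zero, zero_add, ← pow_succ,
      ← pow_succ]

/-- If `a * c` is self-adjoint and `star a * b = 0`, then `a * c` annihilates `b`. -/
theorem mul_mul_eq_zero_of_star_mul_eq_zero {R : Type*} [Semiring R] [StarRing R] {a b c : R}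
    (hac : star (a * c) = a * c) (hab : star a * b = 0) : a * c * b = 0 := by
  rw [← hac, star_mul, mul_assoc, hab, mul_zero]


variable {A : Type*} [NormedRing A] [StarRing A] [NormedAlgebra ℂ A] [CompleteSpace A]

theorem stmt_15 (a b w : A) (ha : IsWStarDMP w a) (hb : IsWStarDMP w b)
    (h1 : a * w * b = 0) (h2 : b * w * a = 0) (h3 : star a * b = 0) :
    IsWStarDMP w (a + b) := by
  obtain ⟨x, m, hm, hx, hax, hxa, hxm⟩ := ha
  obtain ⟨y, n, -, hy, hby, hyb, hyn⟩ := hb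
  have h4 : star b * a = 0 := by simpa using congrArg star h3
  have hx' : a * w * x * w * x = x := by simpa only [pow_two, mul_assoc] using hx
  have hy' : b * w * y * w * y = y := by simpa only [pow_two, mul_assoc] using hy
  have hay : a * w * y = 0 := by
    calc a * w * y = a * w * (b * w * y * w * y) := by rw [hy']
      _ = a * w * b * (w * y * w * y) := by simp only [mul_assoc]
      _ = 0 := by rw [h1, zero_mul]
  have hbx : b * w * x = 0 := by
    calc b * w * x = b * w * (a * w * x * w * x) := by rw [hx']
      _ = b * w * a * (w * x * w * x) := by simp only [mul_assoc]
      _ = 0 := by rw [h2, zero_mul]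
  have hpb : a * w * x * w * b = 0 := by
    have := mul_mul_eq_zero_of_star_mul_eq_zero (a := a) (c := w * x * w) (b := b)
      (by simpa only [mul_assoc] using hax) h3
    simpa only [mul_assoc] using this
  have hqa : b * w * y * w * a = 0 := by
    have := mul_mul_eq_zero_of_star_mul_eq_zero (a := b) (c := w * y * w) (b := a)
      (by simpa only [mul_assoc] using hby) h4
    simpa only [mul_assoc] using this
  have hpy : a * w * x * w * y = 0 := by
    calc a * w * x * w * y = a * w * x * w * (b * w * y * w * y) := by rw [hy']
      _ = a * w * x * w * b * (w * y * w * y) := by simp only [mul_assoc]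
      _ = 0 := by rw [hpb, zero_mul]
  have hqx : b * w * y * w * x = 0 := by
    calc b * w * y * w * x = b * w * y * w * (a * w * x * w * x) := by rw [hx']
      _ = b * w * y * w * a * (w * x * w * x) := by simp only [mul_assoc]
      _ = 0 := by rw [hqa, zero_mul]
  have hxo : x * w * (a * w) * (x * w) = x * w :=
    mul_mul_self_eq_of_pow_eq (by simpa only [mul_assoc] using congrArg (· * w) hx') hxm
  have hyo : y * w * (b * w) * (y * w) = y * w :=
    mul_mul_self_eq_of_pow_eq (by simpa only [mul_assoc] using congrArg (· * w) hy') hyn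
  have hxb : x * w * b = 0 := by
    calc x * w * b = x * w * (a * w) * (x * w) * b := by rw [hxo]
      _ = x * w * (a * w * x * w * b) := by simp only [mul_assoc]
      _ = 0 := by rw [hpb, mul_zero]
  have hya : y * w * a = 0 := by
    calc y * w * a = y * w * (b * w) * (y * w) * a := by rw [hyo]
      _ = y * w * (b * w * y * w * a) := by simp only [mul_assoc]
      _ = 0 := by rw [hqa, mul_zero]
  have hsum : (a + b) * w * (x + y) = a * w * x + b * w * y := by
    simp only [add_mul, mul_add, hay, hbx, add_zero, zero_add]
  have hsum' : (x + y) * w * (a + b) = x * w * a + y * w * b := by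
    simp only [add_mul, mul_add, hxb, hya, add_zero, zero_add]
  have hpq : a * w * (b * w) = 0 := by rw [← mul_assoc, h1, zero_mul]
  have hqp : b * w * (a * w) = 0 := by rw [← mul_assoc, h2, zero_mul]
  refine ⟨x + y, m + n, by omega, ?_, ?_, ?_, ?_⟩
  · calc (a + b) * (w * (x + y)) ^ 2 = (a + b) * w * (x + y) * w * (x + y) := by
          simp only [pow_two, mul_assoc]
      _ = x + y := by
          rw [hsum]
          simp only [add_mul, mul_add, hx', hy', hpy, hqx, add_zero, zero_add]
  · rw [hsum, add_mul, star_add, hax, hby]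
  · rw [hsum', add_mul, star_add, hxa, hyb]
  · have hxq : x * w * (b * w) ^ (m + n + 1) = 0 := by
      rw [pow_succ', ← mul_assoc, ← mul_assoc, hxb, zero_mul, zero_mul]
    have hyp : y * w * (a * w) ^ (m + n + 1) = 0 := by
      rw [pow_succ', ← mul_assoc, ← mul_assoc, hya, zero_mul, zero_mul]
    obtain ⟨k, hk⟩ : ∃ k, m + n = k + 1 := ⟨m + n - 1, by omega⟩
    have hpow : (a * w + b * w) ^ (m + n) = (a * w) ^ (m + n) + (b * w) ^ (m + n) := by
      rw [hk, add_pow_of_mul_eq_zero hpq hqp]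
    rw [add_mul a b, hpow, add_pow_of_mul_eq_zero hpq hqp, add_mul x y, add_mul, mul_add, mul_add,
      hxq, hyp, add_zero, zero_add, ← pow_eq_mul_pow_succ_of_le (Nat.le_add_right m n) hxm,
      ← pow_eq_mul_pow_succ_of_le (Nat.le_add_left n m) hyn]
end

section
/- Let a, w ∈ 𝒜. Then a is w-*-DMP if and only if a is generalized w-EP and aw is Drazin invertible (i.e., there exist z ∈ 𝒜 and a natural number n ≥ 1 such that (aw)z = z(aw), z(aw)z = z, and (aw)^n = z(aw)^{n+1}). -/
variable {A : Type*} [NormedRing A] [StarRing A] [NormedAlgebra ℂ A] [CompleteSpace A]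

section Ring

variable {R : Type*} [Ring R] {b y z : R} {n : ℕ}

theorem pow_mul_pow_succ_of_mul_sq (h : b * y ^ 2 = y) (k : ℕ) : b ^ k * y ^ (k + 1) = y := by
  induction k with
  | zero => simp
  | succ k ih =>
    calc b ^ (k + 1) * y ^ (k + 1 + 1) = b ^ k * (b * y ^ 2) * y ^ k := by
          rw [pow_succ b, show k + 1 + 1 = 2 + k by omega, pow_add]; simp only [mul_assoc]
      _ = y := by rw [h, mul_assoc, ← pow_succ', ih]

theorem pow_mul_pow_add_of_pow_eq (h : b ^ n = y * b ^ (n + 1)) (k : ℕ) :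
    y ^ k * b ^ (n + k) = b ^ n := by
  induction k with
  | zero => simp
  | succ k ih =>
    calc y ^ (k + 1) * b ^ (n + (k + 1)) = y ^ k * (y * b ^ (n + 1)) * b ^ k := by
          rw [pow_succ y, show n + (k + 1) = n + 1 + k by omega, pow_add b (n + 1)]
          simp only [mul_assoc]
      _ = b ^ n := by rw [← h, mul_assoc, ← pow_add, ih]

theorem pow_eq_mul_pow_of_le (h : b ^ n = y * b ^ (n + 1)) {m : ℕ} (hm : n ≤ m) :
    b ^ m = y * b ^ (m + 1) := by
  obtain ⟨k, rfl⟩ := Nat.exists_eq_add_of_le hm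
  rw [show n + k + 1 = n + 1 + k by omega, pow_add, h, pow_add b (n + 1), mul_assoc]

/-- A left inverse of `b` on `b ^ n` with `b * y ^ 2 = y` yields the Drazin inverse
`y ^ (n + 1) * b ^ n` of `b`. -/
theorem exists_drazin_inverse (h : b * y ^ 2 = y) (hn : b ^ n = y * b ^ (n + 1)) :
    ∃ z, b * z = z * b ∧ z * b * z = z ∧ b ^ n = z * b ^ (n + 1) := by
  have hzb : y ^ (n + 1) * b ^ n * b = y ^ n * b ^ n := by
    rw [mul_assoc, ← pow_succ, pow_succ y, mul_assoc, ← hn]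
  refine ⟨y ^ (n + 1) * b ^ n, ?_, ?_, ?_⟩
  · rw [hzb]
    rcases n with _ | n
    · have hy : y * b = 1 := by simpa using hn.symm
      have : b * y = 1 := by
        calc b * y = b * y * (y * b) := by rw [hy, mul_one]
          _ = b * y ^ 2 * b := by rw [sq]; simp only [mul_assoc]
          _ = 1 := by rw [h, hy]
      simp [this]
    · rw [show n + 1 + 1 = 2 + n by omega, pow_add, ← mul_assoc, ← mul_assoc, h, ← pow_succ']
  · rw [hzb, mul_assoc, ← mul_assoc (b ^ n), pow_mul_pow_succ_of_mul_sq h, ← mul_assoc,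
      ← pow_succ]
  · rw [mul_assoc, ← pow_add, pow_mul_pow_add_of_pow_eq hn]

theorem sub_mul_pow_eq_of_commute (hc : b * z = z * b) (h : b ^ n = z * b ^ (n + 1)) (k : ℕ) :
    b ^ n - y * b ^ (n + 1) = (b ^ (n + k) - y * b ^ (n + k + 1)) * z ^ k := by
  have hk : b ^ (n + k) * z ^ k = b ^ n := by
    rw [((show Commute b z from hc).pow_pow _ _).eq, pow_mul_pow_add_of_pow_eq h]
  rw [sub_mul, hk, mul_assoc, pow_succ' b (n + k), mul_assoc, hk, ← pow_succ']

end Ring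

/-- If the `n`-th roots of `‖c n‖` tend to zero, then `c` decays faster than any geometric
sequence. -/
theorem tendsto_norm_mul_pow_of_root_tendsto_zero {E : Type*} [SeminormedAddGroup E] {c : ℕ → E}
    (h : Filter.Tendsto (fun n : ℕ => ‖c n‖ ^ (1 / (n : ℝ))) Filter.atTop (nhds 0))
    {r : ℝ} (hr : 0 < r) :
    Filter.Tendsto (fun n : ℕ => ‖c n‖ * r ^ n) Filter.atTop (nhds 0) := by
  refine squeeze_zero' (.of_forall fun n => by positivity) ?_
    (tendsto_pow_atTop_nhds_zero_of_lt_one (r := (1 / 2 : ℝ)) (by norm_num) (by norm_num))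
  filter_upwards [h.eventually_le_const (show (0 : ℝ) < 1 / (2 * r) by positivity),
    Filter.eventually_ge_atTop 1] with n hn hn1
  have hpow : (‖c n‖ ^ (1 / (n : ℝ))) ^ n = ‖c n‖ := by
    rw [one_div]
    exact Real.rpow_inv_natCast_pow (norm_nonneg _) (by omega)
  calc ‖c n‖ * r ^ n = (‖c n‖ ^ (1 / (n : ℝ))) ^ n * r ^ n := by rw [hpow]
    _ ≤ (1 / (2 * r)) ^ n * r ^ n := by gcongr
    _ = (1 / 2) ^ n := by rw [← mul_pow]; congr 1; field_simp

theorem pow_eq_mul_pow_of_root_tendsto_zero {R : Type*} [NormedRing R] {b y z : R} {n : ℕ}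
    (hc : b * z = z * b) (h : b ^ n = z * b ^ (n + 1))
    (hlim : Filter.Tendsto (fun m : ℕ => ‖b ^ m - y * b ^ (m + 1)‖ ^ (1 / (m : ℝ)))
      Filter.atTop (nhds 0)) :
    b ^ n = y * b ^ (n + 1) := by
  rw [← sub_eq_zero, ← norm_le_zero_iff]
  refine ge_of_tendsto (tendsto_norm_mul_pow_of_root_tendsto_zero hlim
    (show 0 < 1 + ‖z‖ by positivity)) ?_
  filter_upwards [Filter.eventually_ge_atTop (n + 1)] with m hm
  obtain ⟨k, rfl⟩ := Nat.exists_eq_add_of_le (show n ≤ m by omega)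
  have hz : ‖z ^ k‖ ≤ (1 + ‖z‖) ^ (n + k) :=
    calc ‖z ^ k‖ ≤ ‖z‖ ^ k := norm_pow_le' z (by omega)
      _ ≤ (1 + ‖z‖) ^ k := by gcongr; linarith
      _ ≤ (1 + ‖z‖) ^ (n + k) :=
        pow_le_pow_right₀ (by linarith [norm_nonneg z]) (by omega)
  rw [sub_mul_pow_eq_of_commute (y := y) hc h k]
  exact (norm_mul_le _ _).trans (by gcongr)

theorem stmt_16 (a w : A) :
    IsWStarDMP w a ↔
      (IsGenWEP w a ∧
        ∃ z : A, ∃ n : ℕ, 1 ≤ n ∧ (a * w) * z = z * (a * w) ∧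
          z * (a * w) * z = z ∧ (a * w) ^ n = z * (a * w) ^ (n + 1)) := by
  constructor
  · rintro ⟨x, n, hn, hx, h₁, h₂, h⟩
    have hy : a * w * (x * w) ^ 2 = x * w := by
      conv_rhs => rw [← hx]
      simp only [sq, mul_assoc]
    refine ⟨⟨x, hx, h₁, h₂, ?_⟩, ?_⟩
    · refine tendsto_const_nhds.congr' ?_
      filter_upwards [Filter.eventually_ge_atTop n] with m hm
      rw [← pow_eq_mul_pow_of_le h hm, sub_self, norm_zero, Real.zero_rpow]
      have : (m : ℝ) ≠ 0 := by exact_mod_cast (show m ≠ 0 by omega)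
      exact one_div_ne_zero this
    · obtain ⟨z, hz⟩ := exists_drazin_inverse hy h
      exact ⟨z, n, hn, hz⟩
  · rintro ⟨⟨x, hx, h₁, h₂, hlim⟩, z, n, hn, hc, -, h⟩
    exact ⟨x, n, hn, hx, h₁, h₂, pow_eq_mul_pow_of_root_tendsto_zero hc h hlim⟩
end

section
/- Let a, w ∈ 𝒜. The following are equivalent: (1) a is w-*-DMP; (2) there exists a natural number m ≥ 1 such that for every k ≥ m the element a(wa)^{k−1} is w-EP; (3) there exists a natural number k ≥ 1 such that a(wa)^{k−1} is w-EP. -/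
variable {A : Type*} [NormedRing A] [StarRing A] [NormedAlgebra ℂ A] [CompleteSpace A]

section StarMonoid

variable {M : Type*} [Monoid M]

theorem pow_succ_mul_pow_succ_of_mul_mul_self {b y : M} (h : b * y * y = y) (n : ℕ) :
    b ^ (n + 1) * y ^ (n + 1) = b * y := by
  induction n with
  | zero => simp
  | succ n ih =>
    rw [pow_succ' b, pow_succ y, mul_assoc, ← mul_assoc (b ^ (n + 1)), ih, h]

/-- A left inverse of `b` on a power of `b` commutes with `b` as soon as the two associated
idempotents are self-adjoint. -/
theorem commute_of_star_mul_eq [StarMul M] {b y : M} {n : ℕ} (h : b * y * y = y)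
    (hby : star (b * y) = b * y) (hyb : star (y * b) = y * b)
    (hn : y * b ^ (n + 1) = b ^ n) : Commute b y := by
  have h₁ : (b * y) * (y * b) = y * b := by rw [← mul_assoc, h]
  have h₂ : (y * b) * (b * y) = b * y := by
    rw [← pow_succ_mul_pow_succ_of_mul_mul_self h n, ← mul_assoc, mul_assoc y b,
      ← pow_succ', pow_succ b (n + 1), ← mul_assoc y, hn, ← pow_succ]
  have h₃ := congrArg star h₁
  rw [star_mul, hby, hyb, h₂] at h₃
  exact h₃

/-- An element commuting with `p` commutes with the group inverse `z` of `p`. -/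
theorem Commute.of_group_inverse {p z b : M} (hpz : Commute p z) (hz : p * z * z = z)
    (hp : p * z * p = p) (hb : Commute b p) : Commute b z := by
  have hzp : z * p = p * z := hpz.eq.symm
  have hpp : p * (p * z) = p := by rw [← hzp, ← mul_assoc, hp]
  have hzz : z * (p * z) = z := by rw [← mul_assoc, hzp, hz]
  have hl : b * (p * z) = p * z * b * (p * z) := by
    calc b * (p * z) = p * (b * z) := by rw [← mul_assoc, hb.eq, mul_assoc]
      _ = p * z * p * (b * z) := by rw [hp]
      _ = p * z * b * (p * z) := by
        rw [mul_assoc (p * z) p, ← mul_assoc p b z, ← hb.eq]; simp only [mul_assoc]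
  have hr : p * z * b = p * z * b * (p * z) := by
    calc p * z * b = z * (b * p) := by rw [← hzp, mul_assoc, ← hb.eq]
      _ = z * (b * (p * (p * z))) := by rw [hpp]
      _ = z * p * b * (p * z) := by
        rw [← mul_assoc b p, hb.eq]; simp only [mul_assoc]
      _ = p * z * b * (p * z) := by rw [hzp]
  have he : b * (p * z) = p * z * b := hl.trans hr.symm
  calc b * z = b * (p * z * z) := by rw [hz]
    _ = p * z * b * z := by rw [← mul_assoc, he]
    _ = z * (b * (p * z)) := by
      rw [← hzp, mul_assoc z p b, ← hb.eq, hzp]; simp only [mul_assoc]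
    _ = z * b := by rw [he, ← mul_assoc, hzz]

theorem mul_mul_pow_mul (a w : M) (j : ℕ) : a * (w * a) ^ j = (a * w) ^ j * a := by
  induction j with
  | zero => simp
  | succ j ih => rw [pow_succ, ← mul_assoc, ih, pow_succ]; simp only [mul_assoc]

theorem mul_mul_sq (c w x : M) : c * (w * x) ^ 2 = c * w * (x * w) * x := by
  rw [pow_two]; simp only [mul_assoc]

end StarMonoid

theorem IsWStarDMP.isWEP_mul_pow {a w : A}
    (h : IsWStarDMP w a) :
    ∃ m : ℕ, 1 ≤ m ∧ ∀ k : ℕ, m ≤ k → IsWEP w (a * (w * a) ^ (k - 1)) := by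
  obtain ⟨x, n, -, hx, h₁, h₂, hn⟩ := h
  have hx' : a * w * (x * w) * x = x := by
    rw [← mul_mul_sq, hx]
  have hy : a * w * (x * w) * (x * w) = x * w := by rw [← mul_assoc, hx']
  rw [mul_assoc (a * w)] at h₁
  rw [mul_assoc (x * w)] at h₂
  have hc := commute_of_star_mul_eq hy h₁ h₂ hn.symm
  refine ⟨n + 1, by omega, fun k hk => ?_⟩
  obtain ⟨j, rfl⟩ : ∃ j, k = n + j + 1 := ⟨k - (n + 1), by omega⟩
  have hp := pow_succ_mul_pow_succ_of_mul_mul_self hy (n + j)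
  have hcp : (x * w) ^ (n + j + 1) * (a * w) ^ (n + j + 1) = a * w * (x * w) := by
    rw [← hp]; exact (hc.pow_pow _ _).eq.symm
  have hcw : (a * w) ^ (n + j) * a * w = (a * w) ^ (n + j + 1) := by
    rw [pow_succ, mul_assoc]
  have hxw : (x * w) ^ (n + j) * x * w = (x * w) ^ (n + j + 1) := by
    rw [pow_succ, mul_assoc]
  rw [Nat.add_sub_cancel, mul_mul_pow_mul]
  refine ⟨(x * w) ^ (n + j) * x, ?_, ?_, ?_, ?_⟩
  · rw [mul_mul_sq, hcw, hxw, hp,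
      ← mul_assoc, ((hc.mul_left (Commute.refl _)).pow_right (n + j)).eq, mul_assoc, hx']
  · rw [mul_mul_sq, hxw, hcw, hcp,
      ← mul_assoc, hc.eq, pow_add, ← mul_assoc, mul_assoc (x * w), ← pow_succ', ← hn]
  · rw [hcw, mul_assoc _ _ w, hxw, hp, h₁]
  · rw [hxw, mul_assoc _ _ w, hcw, hcp, h₁]

theorem IsWStarDMP.of_isWEP_mul_pow {a w : A} {j : ℕ}
    (h : IsWEP w (a * (w * a) ^ j)) : IsWStarDMP w a := by
  rw [mul_mul_pow_mul] at h
  obtain ⟨x, hx, hc, h₁, h₂⟩ := h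
  have hcw : (a * w) ^ j * a * w = (a * w) ^ (j + 1) := by rw [pow_succ, mul_assoc]
  rw [mul_mul_sq, hcw] at hx
  rw [mul_mul_sq, hcw] at hc
  rw [hcw, mul_assoc _ x w] at h₁
  rw [mul_assoc _ _ w, hcw] at h₂
  have hz : (a * w) ^ (j + 1) * (x * w) * (x * w) = x * w := by rw [← mul_assoc, hx]
  have hzp : x * w * (a * w) ^ (j + 1) * (a * w) ^ (j + 1) = (a * w) ^ (j + 1) := by
    calc x * w * (a * w) ^ (j + 1) * (a * w) ^ (j + 1)
        = x * w * (a * w) ^ (j + 1) * ((a * w) ^ j * a) * w := by rw [mul_assoc _ _ w, hcw]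
      _ = (a * w) ^ (j + 1) := by rw [hc, hcw]
  have hpz : Commute ((a * w) ^ (j + 1)) (x * w) :=
    commute_of_star_mul_eq (n := 1) hz h₁ h₂ (by rw [pow_one, pow_two, ← mul_assoc, hzp])
  have hp : (a * w) ^ (j + 1) * (x * w) * (a * w) ^ (j + 1) = (a * w) ^ (j + 1) := by
    rw [hpz.eq, hzp]
  have hbz : Commute (a * w) (x * w) :=
    hpz.of_group_inverse hz hp ((Commute.refl _).pow_right _)
  have hby : a * w * ((a * w) ^ j * (x * w)) = (a * w) ^ (j + 1) * (x * w) := by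
    rw [← mul_assoc, ← pow_succ']
  have hyb : (a * w) ^ j * (x * w) * (a * w) = (a * w) ^ (j + 1) * (x * w) := by
    rw [mul_assoc, ← hbz.eq, ← mul_assoc, ← pow_succ]
  refine ⟨(a * w) ^ j * x, j + 1, by omega, ?_, ?_, ?_, ?_⟩
  · rw [mul_mul_sq, mul_assoc _ x w, hby,
      ← mul_assoc, mul_assoc (_ ^ (j + 1)), ← (hbz.pow_left j).eq, ← mul_assoc,
      ← pow_add, add_comm (j + 1) j, pow_add, mul_assoc, mul_assoc, ← mul_assoc (_ ^ (j + 1)), hx]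
  · rw [mul_assoc _ _ w, mul_assoc _ x w, hby, h₁]
  · rw [mul_assoc _ x w, mul_assoc _ a w, hyb, h₁]
  · rw [mul_assoc _ x w, pow_succ' _ (j + 1), ← mul_assoc, hyb, hp]

theorem stmt_18 (a w : A) :
    [ IsWStarDMP w a,
      (∃ m : ℕ, 1 ≤ m ∧ ∀ k : ℕ, m ≤ k → IsWEP w (a * (w * a) ^ (k - 1))),
      (∃ k : ℕ, 1 ≤ k ∧ IsWEP w (a * (w * a) ^ (k - 1))) ].TFAE := by
  tfae_have 1 → 2 := IsWStarDMP.isWEP_mul_pow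
  tfae_have 2 → 3 := fun ⟨m, hm, h⟩ => ⟨m, hm, h m le_rfl⟩
  tfae_have 3 → 1 := fun ⟨_, _, h⟩ => .of_isWEP_mul_pow h
  tfae_finish
end

section
/- Let a, w ∈ 𝒜. Then a is w-*-DMP if and only if there exists a natural number k ≥ 1 such that (aw)^{k−1}a is w-group invertible and (aw)^{k−1}a𝒜 = ((aw)^k)*𝒜 (that is, the sets {(aw)^{k−1}a·r : r ∈ 𝒜} and {((aw)^k)*·r : r ∈ 𝒜} coincide). -/
variable {A : Type*} [NormedRing A] [StarRing A] [NormedAlgebra ℂ A] [CompleteSpace A]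

section Monoid

variable {M : Type*} [Monoid M]

theorem mul_pow_mul_pow_succ_of_mul_sq {b y : M} (h : b * y ^ 2 = y) (m : ℕ) :
    b ^ m * y ^ (m + 1) = y := by
  induction m with
  | zero => simp
  | succ m ih =>
    calc b ^ (m + 1) * y ^ (m + 1 + 1) = b ^ m * (b * y ^ 2) * y ^ m := by
          rw [pow_succ, show m + 1 + 1 = 2 + m by omega, pow_add]; simp only [mul_assoc]
      _ = y := by rw [h, mul_assoc, ← pow_succ', ih]

theorem mul_eq_pow_mul_pow_of_mul_sq {b y : M} (h : b * y ^ 2 = y) (m : ℕ) :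
    b * y = b ^ (m + 1) * y ^ (m + 1) := by
  conv_lhs => rw [← mul_pow_mul_pow_succ_of_mul_sq h m]
  rw [← mul_assoc, ← pow_succ']

/-- If `b * y` and `y * b` are self-adjoint, a core-EP inverse `y` of `b` commutes with `b`. -/
theorem commute_of_mul_sq_of_isSelfAdjoint [StarMul M] {b y : M} {n : ℕ} (h : b * y ^ 2 = y)
    (hby : star (b * y) = b * y) (hyb : star (y * b) = y * b) (hn : b ^ n = y * b ^ (n + 1)) :
    Commute b y := by
  have hfe : y * b * (b * y) = b * y := by
    rw [mul_eq_pow_mul_pow_of_mul_sq h n, ← mul_assoc, pow_succ' b n, ← pow_succ' b n]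
    calc y * b * b ^ (n + 1) * y ^ (n + 1)
        = y * b ^ (n + 1) * b * y ^ (n + 1) := by
          rw [mul_assoc y b, mul_assoc y _ b, ← pow_succ, ← pow_succ']
      _ = b ^ (n + 1) * y ^ (n + 1) := by rw [← hn, ← pow_succ]
  have hef : b * y * (y * b) = y * b := by
    calc b * y * (y * b) = b * y ^ 2 * b := by simp only [pow_two, mul_assoc]
      _ = y * b := by rw [h]
  have := congrArg star hef
  rw [star_mul, hby, hyb, hfe] at this
  exact this

/-- An element commuting with `c` commutes with the group inverse `v` of `c`. -/
theorem Commute.of_group_inverse_s19 {b c v : M} (hb : Commute b c) (hcvc : c * v * c = c)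
    (hvcv : v * c * v = v) (hcv : c * v = v * c) : Commute b v := by
  have h₁ : c * v * b * (c * v) = c * v * b := by
    calc c * v * b * (c * v) = v * (c * b) * v * c := by rw [hcv]; simp only [mul_assoc]
      _ = v * b * (c * v * c) := by rw [← hb.eq]; simp only [mul_assoc]
      _ = c * v * b := by rw [hcvc, mul_assoc, hb.eq, ← mul_assoc, hcv]
  have h₂ : c * v * b * (c * v) = b * (c * v) := by
    calc c * v * b * (c * v) = c * v * (b * c) * v := by simp only [mul_assoc]
      _ = c * v * c * b * v := by rw [hb.eq]; simp only [mul_assoc]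
      _ = b * (c * v) := by rw [hcvc, ← hb.eq, mul_assoc]
  have h₃ : c * v * b = b * (c * v) := h₁.symm.trans h₂
  have h₄ : v * b = b * v := by
    calc v * b = v * (c * v * b) := by rw [← mul_assoc, ← mul_assoc, hvcv]
      _ = v * (b * c) * v := by rw [h₃]; simp only [mul_assoc]
      _ = c * v * b * v := by rw [hb.eq, hcv]; simp only [mul_assoc]
      _ = b * (v * c * v) := by rw [h₃, hcv, mul_assoc]
      _ = b * v := by rw [hvcv]
  exact h₄.symm

/-- Two elements generate the same right ideal iff each is a left divisor of
the other. -/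
theorem range_mul_left_eq_iff_dvd {s t : M} :
    ((Set.range fun r : M => s * r) = Set.range fun r : M => t * r) ↔ t ∣ s ∧ s ∣ t := by
  constructor
  · intro h
    constructor
    · obtain ⟨r, hr⟩ := h.le ⟨1, rfl⟩
      exact ⟨r, by simpa using hr.symm⟩
    · obtain ⟨r, hr⟩ := h.ge ⟨1, rfl⟩
      exact ⟨r, by simpa using hr.symm⟩
  · rintro ⟨⟨p, hp⟩, ⟨q, hq⟩⟩
    apply Set.Subset.antisymm
    · rintro _ ⟨r, rfl⟩
      exact ⟨p * r, by simp only [← mul_assoc, ← hp]⟩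
    · rintro _ ⟨r, rfl⟩
      exact ⟨q * r, by simp only [← mul_assoc, ← hq]⟩

/-- If `star c` divides `c`, the spectral idempotent `c * v` of a group inverse `v` of `c` is
self-adjoint. -/
theorem star_mul_eq_of_star_dvd [StarMul M] {c v : M} (hcvc : c * v * c = c)
    (hcv : c * v = v * c) (h : star c ∣ c) : star (c * v) = c * v := by
  obtain ⟨s, hs⟩ := h
  have h₁ : c * (c * v) = c := by rw [hcv, ← mul_assoc, hcvc]
  have h₂ : star (c * v) * star c = star c := by rw [← star_mul, h₁]
  have h₃ : star (c * v) * (c * v) = c * v := by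
    have h₄ : star (c * v) * c = c := by
      calc star (c * v) * c = star (c * v) * star c * s := by rw [mul_assoc, ← hs]
        _ = c := by rw [h₂, ← hs]
    rw [← mul_assoc, h₄]
  rw [← h₃, star_mul, star_star]

end Monoid

theorem IsWStarDMP.exists_isWGroupInv {R : Type*} [NormedRing R] [StarRing R] {w a : R}
    (h : IsWStarDMP w a) :
    ∃ n : ℕ, (∃ x : R, IsWGroupInv w ((a * w) ^ n * a) x) ∧
      star ((a * w) ^ (n + 1)) ∣ (a * w) ^ n * a ∧
      (a * w) ^ n * a ∣ star ((a * w) ^ (n + 1)) := by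
  obtain ⟨x, n, -, hx, h₁, h₂, hn⟩ := h
  obtain ⟨b, hb⟩ : ∃ b, b = a * w := ⟨_, rfl⟩
  obtain ⟨y, hy⟩ : ∃ y, y = x * w := ⟨_, rfl⟩
  have hsq : b * y ^ 2 = y := by
    rw [hb, hy]
    conv_rhs => rw [← hx]
    simp only [pow_two, mul_assoc]
  have hby : star (b * y) = b * y := by simpa only [hb, hy, mul_assoc] using h₁
  have hyb : star (y * b) = y * b := by simpa only [hb, hy, mul_assoc] using h₂
  rw [← hb, ← hy] at hn
  rw [← hb]
  have hc : Commute b y := commute_of_mul_sq_of_isSelfAdjoint hsq hby hyb hn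
  have hyby : b * y * y = y := by rw [mul_assoc, ← pow_two, hsq]
  have hez : b * y * b ^ n = b ^ n := by
    rw [hc.eq, mul_assoc, ← pow_succ', ← hn]
  have hpow : b ^ (n + 1) * y ^ (n + 1) = b * y := (mul_eq_pow_mul_pow_of_mul_sq hsq n).symm
  have hpow' : y ^ (n + 1) * b ^ (n + 1) = b * y := by
    rw [← (hc.pow_pow (n + 1) (n + 1)).eq, hpow]
  have hbe : b ^ (n + 1) * (b * y) = b ^ (n + 1) := by
    rw [← mul_assoc, ← pow_succ, (hc.pow_left _).eq, pow_succ b (n + 1), ← mul_assoc, ← hn,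
      pow_succ]
  have hzw : b ^ n * a * w = b ^ (n + 1) := by rw [mul_assoc, ← hb, pow_succ]
  have huw : y ^ (n + 2) * a * w = y ^ (n + 1) := by
    rw [mul_assoc, ← hb, ← (hc.pow_right (n + 2)).eq, pow_succ', pow_succ', ← mul_assoc,
      ← mul_assoc, hyby]
  have hzwu : b ^ n * a * w * (y ^ (n + 2) * a) = y * a := by
    rw [hzw, ← mul_assoc, pow_succ y (n + 1), ← mul_assoc, hpow, hyby]
  have huwz : y ^ (n + 2) * a * w * (b ^ n * a) = y * a := by
    rw [huw, ← mul_assoc, ← (hc.pow_pow n (n + 1)).eq, mul_pow_mul_pow_succ_of_mul_sq hsq n]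
  refine ⟨n, ⟨y ^ (n + 2) * a, ?_, ?_, ?_⟩, ?_, ?_⟩
  · rw [hzwu, mul_assoc y, ← hb, ← hc.eq, ← mul_assoc, hez]
  · rw [huwz, mul_assoc y, ← hb, ← hc.eq, ← mul_assoc, pow_succ', ← mul_assoc, hyby]
  · rw [hzwu, huwz]
  · refine ⟨star (y ^ (n + 1)) * (b ^ n * a), ?_⟩
    rw [← mul_assoc, ← star_mul, hpow', hby, ← mul_assoc, hez]
  · refine ⟨w * y ^ (n + 1) * star (b ^ (n + 1)), ?_⟩
    rw [← mul_assoc, ← mul_assoc, hzw, hpow]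
    conv_rhs => rw [← hby]
    rw [← star_mul, hbe]

theorem IsWGroupInv.isWStarDMP {R : Type*} [NormedRing R] [StarRing R] {w a u : R} {n : ℕ}
    (h : IsWGroupInv w ((a * w) ^ n * a) u)
    (hdvd : star ((a * w) ^ (n + 1)) ∣ (a * w) ^ n * a) : IsWStarDMP w a := by
  obtain ⟨h₁, h₂, h₃⟩ := h
  obtain ⟨b, hb⟩ : ∃ b, b = a * w := ⟨_, rfl⟩
  obtain ⟨c, hc⟩ : ∃ c, c = b ^ (n + 1) := ⟨_, rfl⟩
  obtain ⟨v, hv⟩ : ∃ v, v = u * w := ⟨_, rfl⟩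
  rw [← hb] at h₁ h₂ h₃ hdvd
  have hzw : b ^ n * a * w = c := by rw [mul_assoc, ← hb, hc, pow_succ]
  rw [hzw] at h₁ h₃
  have hcu : v * c * u = u := by
    rw [hv]
    simpa only [← hzw, mul_assoc] using h₂
  have hcvc : c * v * c = c := by
    rw [← hzw] at h₁ ⊢
    have := congrArg (· * w) h₁
    simpa only [hv, mul_assoc] using this
  have hcv : c * v = v * c := by
    rw [hv, ← mul_assoc, h₃, mul_assoc, hzw]
  have hvcv : v * c * v = v := by
    conv_lhs => rw [hv, ← mul_assoc, ← hv, hcu]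
    exact hv.symm
  have hbv : Commute b v :=
    Commute.of_group_inverse_s19 (hc ▸ Commute.self_pow b (n + 1)) hcvc hvcv hcv
  have hstar : star (c * v) = c * v := by
    refine star_mul_eq_of_star_dvd hcvc hcv ?_
    rw [hc] at hzw ⊢
    exact hzw ▸ hdvd.mul_right w
  have hby : b * (b ^ n * v) = c * v := by rw [← mul_assoc, ← pow_succ', hc]
  have hyb : b ^ n * v * b = c * v := by rw [mul_assoc, ← hbv.eq, ← mul_assoc, ← pow_succ, hc]
  have hxw : b ^ n * u * w = b ^ n * v := by rw [mul_assoc, hv]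
  have hawxw : a * w * (b ^ n * u) * w = c * v := by rw [← hb, mul_assoc, hxw, hby]
  have hcbn : c * v * b ^ n = b ^ n * (c * v) := by
    rw [← hby]
    exact (((Commute.refl b).mul_left ((Commute.self_pow b n).symm.mul_left hbv.symm)).pow_right n).eq
  refine ⟨b ^ n * u, n + 1, Nat.le_add_left 1 n, ?_, ?_, ?_, ?_⟩
  · calc a * (w * (b ^ n * u)) ^ 2 = a * w * (b ^ n * u) * w * (b ^ n * u) := by
          simp only [pow_two, mul_assoc]
      _ = b ^ n * (v * c * u) := by
          rw [hawxw, ← mul_assoc, hcbn, hcv, mul_assoc]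
      _ = b ^ n * u := by rw [hcu]
  · rw [hawxw, hstar]
  · rw [hxw, mul_assoc _ a w, ← hb, hyb, hstar]
  · rw [hxw, ← hb, pow_succ' b (n + 1), ← mul_assoc, hyb, ← hc, hcvc]

theorem stmt_19 (a w : A) :
    IsWStarDMP w a ↔
      ∃ k : ℕ, 1 ≤ k ∧ (∃ x : A, IsWGroupInv w ((a * w) ^ (k - 1) * a) x) ∧
        (Set.range fun r : A => (a * w) ^ (k - 1) * a * r) =
          (Set.range fun r : A => star ((a * w) ^ k) * r) := by
  constructor
  · intro h
    obtain ⟨n, hx, hdvd⟩ := h.exists_isWGroupInv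
    exact ⟨n + 1, Nat.le_add_left 1 n, hx, range_mul_left_eq_iff_dvd.2 hdvd⟩
  · rintro ⟨k, hk, ⟨x, hx⟩, hrange⟩
    obtain ⟨n, rfl⟩ := Nat.exists_eq_add_of_le' hk
    exact hx.isWStarDMP (range_mul_left_eq_iff_dvd.1 hrange).1
end
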